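/- arXiv:1707.03285 — 12 statements merged into one kernel-verified Lean document; each statement's English description precedes it below -/
import Mathlib

section
/- Let K be a field, let X be a finite subset of ℙ^{s−1}, and let F = {f_1,…,f_r} be a set of nonzero homogeneous polynomials of S. Then V_X(F) = ∅ if and only if the colon ideal (I(X) : (f_1,…,f_r)) equals I(X). -/
open MvPolynomial

/-- The vanishing ideal `I(X)` of a set `X` of points of the projective space `ℙ^{s-1}`:
the ideal generated by the homogeneous polynomials vanishing at all points of `X`
(evaluation at a point is evaluation at the chosen representative, which for homogeneous
polynomials detects vanishing independently of the representative). -/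
noncomputable def vanishingIdeal {K : Type*} [Field K] {s : ℕ}
    (X : Set (Projectivization K (Fin s → K))) : Ideal (MvPolynomial (Fin s) K) :=
  Ideal.span {g : MvPolynomial (Fin s) K |
    (∃ d, g.IsHomogeneous d) ∧ ∀ p ∈ X, eval p.rep g = 0}

/-- `V_X(F)`, the set of zeros in `X` of a family `F` of homogeneous polynomials. -/
def projZeroSet {K : Type*} [Field K] {s r : ℕ}
    (X : Set (Projectivization K (Fin s → K))) (f : Fin r → MvPolynomial (Fin s) K) :
    Set (Projectivization K (Fin s → K)) :=
  {p ∈ X | ∀ i, eval p.rep (f i) = 0}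

/-- Restriction of polynomials to the line spanned by `v`: the variable `t_i` is sent to `v_i T`. -/
noncomputable def restrictLine {K : Type*} [Field K] {s : ℕ} (v : Fin s → K) :
    MvPolynomial (Fin s) K →+* Polynomial K :=
  eval₂Hom Polynomial.C fun i => Polynomial.C (v i) * Polynomial.X

theorem restrictLine_of_isHomogeneous {K : Type*} [Field K] {s : ℕ} (v : Fin s → K)
    {g : MvPolynomial (Fin s) K} {d : ℕ} (hg : g.IsHomogeneous d) :
    restrictLine v g = Polynomial.C (eval v g) * Polynomial.X ^ d := by
  rw [restrictLine, coe_eval₂Hom, eval₂_eq', eval_eq', map_sum, Finset.sum_mul]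
  refine Finset.sum_congr rfl fun m hm => ?_
  have hd : ∑ i, m i = d := by
    rw [← Finsupp.degree_eq_sum, hg.degree_eq_sum_deg_support hm, Finsupp.degree_apply]
  simp only [mul_pow, Finset.prod_mul_distrib, Finset.prod_pow_eq_pow_sum, hd, map_mul, map_prod,
    map_pow, mul_assoc]

theorem restrictLine_eq_zero_iff_of_isHomogeneous {K : Type*} [Field K] {s : ℕ} (v : Fin s → K)
    {g : MvPolynomial (Fin s) K} {d : ℕ} (hg : g.IsHomogeneous d) :
    restrictLine v g = 0 ↔ eval v g = 0 := by
  rw [restrictLine_of_isHomogeneous v hg]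
  simp

theorem coeff_restrictLine {K : Type*} [Field K] {s : ℕ} (v : Fin s → K)
    (g : MvPolynomial (Fin s) K) (n : ℕ) :
    (restrictLine v g).coeff n = eval v (homogeneousComponent n g) := by
  conv_lhs => rw [← sum_homogeneousComponent g, map_sum]
  simp only [restrictLine_of_isHomogeneous v (homogeneousComponent_isHomogeneous _ g),
    Polynomial.finsetSum_coeff, Polynomial.coeff_C_mul_X_pow, Finset.sum_ite_eq,
    Finset.mem_range]
  split_ifs with h
  · rfl
  · rw [homogeneousComponent_eq_zero n g (by omega), map_zero]

theorem mem_vanishingIdeal_iff_restrictLine {K : Type*} [Field K] {s : ℕ}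
    (X : Set (Projectivization K (Fin s → K))) (g : MvPolynomial (Fin s) K) :
    g ∈ vanishingIdeal X ↔ ∀ p ∈ X, restrictLine p.rep g = 0 := by
  constructor
  · intro hg p hp
    have hle : vanishingIdeal X ≤ RingHom.ker (restrictLine p.rep) := by
      refine Ideal.span_le.2 ?_
      rintro h ⟨⟨d, hd⟩, hh⟩
      exact (restrictLine_eq_zero_iff_of_isHomogeneous _ hd).2 (hh p hp)
    exact hle hg
  · intro hg
    rw [← sum_homogeneousComponent g]
    refine Ideal.sum_mem _ fun n _ => Ideal.subset_span
      ⟨⟨n, homogeneousComponent_isHomogeneous n g⟩, fun p hp => ?_⟩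
    rw [← coeff_restrictLine, hg p hp, Polynomial.coeff_zero]

/-- Two distinct points of projective space are separated by a linear form. -/
theorem exists_restrictLine_eq_zero_and_ne_zero {K : Type*} [Field K] {s : ℕ}
    {p q : Projectivization K (Fin s → K)} (hpq : q ≠ p) :
    ∃ g : MvPolynomial (Fin s) K, restrictLine q.rep g = 0 ∧ restrictLine p.rep g ≠ 0 := by
  obtain ⟨j, hj⟩ := Function.ne_iff.1 q.rep_nonzero
  rw [Pi.zero_apply] at hj
  obtain ⟨i, hi⟩ : ∃ i, q.rep j * p.rep i - q.rep i * p.rep j ≠ 0 := by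
    by_contra! h
    refine hpq ?_
    rw [← p.mk_rep, ← q.mk_rep, eq_comm, Projectivization.mk_eq_mk_iff']
    refine ⟨p.rep j / q.rep j, funext fun i => ?_⟩
    rw [Pi.smul_apply, smul_eq_mul]
    field_simp
    linear_combination -h i
  have hhom : (C (q.rep j) * X i - C (q.rep i) * X j : MvPolynomial (Fin s) K).IsHomogeneous 1 :=
    (isHomogeneous_C_mul_X _ _).sub (isHomogeneous_C_mul_X _ _)
  refine ⟨_, (restrictLine_eq_zero_iff_of_isHomogeneous _ hhom).2 ?_,
    (restrictLine_eq_zero_iff_of_isHomogeneous _ hhom).not.2 ?_⟩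
  · simp [mul_comm]
  · simpa using hi

/-- A point is separated from a finite set of other points by a polynomial. -/
theorem exists_restrictLine_ne_zero_of_finite {K : Type*} [Field K] {s : ℕ}
    {X : Set (Projectivization K (Fin s → K))} (hX : X.Finite)
    (p : Projectivization K (Fin s → K)) :
    ∃ g : MvPolynomial (Fin s) K,
      (∀ q ∈ X, q ≠ p → restrictLine q.rep g = 0) ∧ restrictLine p.rep g ≠ 0 := by
  classical
  choose! l hl hlp using fun (q : Projectivization K (Fin s → K)) (h : q ≠ p) =>
    exists_restrictLine_eq_zero_and_ne_zero h
  refine ⟨∏ q ∈ hX.toFinset.erase p, l q, fun q hq hqp => ?_, ?_⟩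
  · rw [map_prod]
    exact Finset.prod_eq_zero (Finset.mem_erase.2 ⟨hqp, hX.mem_toFinset.2 hq⟩) (hl q hqp)
  · rw [map_prod]
    exact Finset.prod_ne_zero_iff.2 fun q hq => hlp q (Finset.ne_of_mem_erase hq)

theorem mem_colon_span_range_iff {R ι : Type*} [CommRing R] (I : Ideal R) (f : ι → R) (g : R) :
    g ∈ I.colon (Ideal.span (Set.range f)) ↔ ∀ i, g * f i ∈ I := by
  rw [Submodule.mem_colon]
  refine ⟨fun h i => h _ (Ideal.subset_span ⟨i, rfl⟩), fun h x hx => ?_⟩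
  have hle : Ideal.span (Set.range f) ≤ Submodule.comap (LinearMap.mulLeft R g) I :=
    Ideal.span_le.2 (by rintro _ ⟨i, rfl⟩; exact h i)
  exact hle hx

/-- Let `K` be a field, `X` a finite subset of `ℙ^{s-1}`, and
`F = {f_1, …, f_r}` a set of nonzero homogeneous polynomials of `S = K[t_1, …, t_s]`.
Then `V_X(F) = ∅` if and only if the colon ideal `(I(X) : (f_1, …, f_r))` equals `I(X)`. -/
theorem stmt_1 {K : Type*} [Field K] {s r : ℕ} (hr : 0 < r)
    (X : Set (Projectivization K (Fin s → K))) (hX : X.Finite)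
    (f : Fin r → MvPolynomial (Fin s) K) (hf0 : ∀ i, f i ≠ 0)
    (hfh : ∀ i, ∃ d, (f i).IsHomogeneous d) :
    projZeroSet X f = ∅ ↔
      (vanishingIdeal X).colon (Ideal.span (Set.range f)) = vanishingIdeal X := by
  constructor
  · intro hV
    ext g
    simp only [mem_colon_span_range_iff, mem_vanishingIdeal_iff_restrictLine, map_mul]
    refine ⟨fun h p hp => ?_, fun h i p hp => by rw [h p hp, zero_mul]⟩
    obtain ⟨i, hi⟩ : ∃ i, eval p.rep (f i) ≠ 0 := by
      by_contra! h0
      exact Set.notMem_empty p (hV ▸ ⟨hp, h0⟩)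
    obtain ⟨d, hd⟩ := hfh i
    exact (mul_eq_zero.1 (h i p hp)).resolve_right
      ((restrictLine_eq_zero_iff_of_isHomogeneous _ hd).not.2 hi)
  · intro hI
    refine Set.eq_empty_of_forall_notMem ?_
    rintro p ⟨hp, hpf⟩
    obtain ⟨g, hg, hgp⟩ := exists_restrictLine_ne_zero_of_finite hX p
    have hmem : g ∈ vanishingIdeal X := by
      rw [← hI]
      simp only [mem_colon_span_range_iff, mem_vanishingIdeal_iff_restrictLine, map_mul]
      intro i q hq
      by_cases hqp : q = p
      · obtain ⟨d, hd⟩ := hfh i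
        rw [hqp, (restrictLine_eq_zero_iff_of_isHomogeneous _ hd).2 (hpf i), mul_zero]
      · rw [hg q hq hqp, zero_mul]
    exact hgp ((mem_vanishingIdeal_iff_restrictLine X g).1 hmem p hp)
end

section
/- Let K be a field and let X = {[P_1],…,[P_m]} ⊆ ℙ^{s−1} be a finite set of m distinct projective points with fixed representatives P_1,…,P_m ∈ K^s. Fix d ≥ 1 and let 1 ≤ r ≤ dim_K C_X(d). Then the r-th generalized Hamming weight of C_X(d) satisfies δ_r(C_X(d)) = min{ |X ∖ V_X({f_1,…,f_r})| : f_1,…,f_r ∈ S_d and ev_d(f_1),…,ev_d(f_r) are linearly independent over K }. -/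
open MvPolynomial

/-- The evaluation map `ev_d` (as a linear map on all of `S = K[t_1,…,t_s]`):
`f ↦ (f(P_1), …, f(P_m))`. -/
noncomputable def evLin {K : Type*} [Field K] {s m : ℕ} (P : Fin m → (Fin s → K)) :
    MvPolynomial (Fin s) K →ₗ[K] (Fin m → K) :=
  LinearMap.pi fun i => (MvPolynomial.aeval (P i)).toLinearMap

/-- The support of a span is the union of the supports of the spanning vectors. -/
theorem exists_mem_span_range_apply_ne_zero_iff {K ι κ : Type*} [Field K] (v : κ → ι → K) (i : ι) :
    (∃ w ∈ Submodule.span K (Set.range v), w i ≠ 0) ↔ ∃ j, v j i ≠ 0 := by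
  refine ⟨fun ⟨w, hw, hwi⟩ => ?_,
    fun ⟨j, hj⟩ => ⟨v j, Submodule.subset_span (Set.mem_range_self j), hj⟩⟩
  by_contra! h
  have hle : Submodule.span K (Set.range v) ≤ LinearMap.ker (LinearMap.proj i : (ι → K) →ₗ[K] K) :=
    Submodule.span_le.2 (by rintro _ ⟨j, rfl⟩; exact h j)
  exact hwi (hle hw)

/-- Let `K` be a field and let `X = {[P_1], …, [P_m]} ⊆ ℙ^{s-1}` be a finite
set of `m` distinct projective points with fixed representatives `P_1, …, P_m ∈ K^s`.
Fix `d ≥ 1` and `1 ≤ r ≤ dim_K C_X(d)`, where `C_X(d)` is the image of the degree-`d`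
homogeneous component under the evaluation map.  Then the `r`-th generalized Hamming weight
of `C_X(d)` (the minimal support size of an `r`-dimensional subcode) equals
`min { |X ∖ V_X({f_1,…,f_r})| }`, the minimum being over families `f_1, …, f_r ∈ S_d` whose
evaluations are linearly independent over `K`. -/
theorem stmt_3 {K : Type*} [Field K] {s m : ℕ} (hm : 0 < m)
    (P : Fin m → (Fin s → K)) (hP0 : ∀ i, P i ≠ 0)
    (hPdist : ∀ i j : Fin m, i ≠ j → ∀ c : K, P j ≠ c • P i)
    (d r : ℕ) (hd : 1 ≤ d) (hr : 1 ≤ r)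
    (hrk : r ≤ Module.finrank K
      ((homogeneousSubmodule (Fin s) K d).map (evLin P))) :
    sInf {c : ℕ | ∃ D : Submodule K (Fin m → K),
        D ≤ (homogeneousSubmodule (Fin s) K d).map (evLin P) ∧
        Module.finrank K D = r ∧ {i : Fin m | ∃ v ∈ D, v i ≠ 0}.ncard = c} =
    sInf {c : ℕ | ∃ f : Fin r → MvPolynomial (Fin s) K,
        (∀ j, (f j).IsHomogeneous d) ∧
        LinearIndependent K (fun j => evLin P (f j)) ∧
        {i : Fin m | ∃ j, aeval (P i) (f j) ≠ 0}.ncard = c} := by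
  congr 1
  ext c
  constructor
  · rintro ⟨D, hD, hDr, rfl⟩
    let b := Module.finBasisOfFinrankEq K D hDr
    choose f hf hfb using fun j => hD (b j).2
    have hspan : Submodule.span K (Set.range fun j => evLin P (f j)) = D := by
      simp_rw [hfb]
      rw [Set.range_comp' Subtype.val b, ← D.coe_subtype, Submodule.span_image, b.span_eq,
        Submodule.map_top, Submodule.range_subtype]
    refine ⟨f, hf, ?_, ?_⟩
    · simp_rw [hfb]
      exact b.linearIndependent.map' D.subtype D.ker_subtype
    · congr 1
      ext i
      rw [← hspan]
      exact (exists_mem_span_range_apply_ne_zero_iff (fun j => evLin P (f j)) i).symm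
  · rintro ⟨f, hf, hli, rfl⟩
    refine ⟨Submodule.span K (Set.range fun j => evLin P (f j)), ?_, ?_, ?_⟩
    · rw [Submodule.span_le]
      rintro _ ⟨j, rfl⟩
      exact Submodule.mem_map_of_mem (hf j)
    · simpa using finrank_span_eq_card hli
    · congr 1
      ext i
      exact exists_mem_span_range_apply_ne_zero_iff (fun j => evLin P (f j)) i
end

section
/- Let ≺ be a monomial order on S = K[t_1,…,t_s], let I ⊆ S be an ideal, and let f_1,…,f_r be polynomials of S of positive degree. If the colon ideal (in_≺(I) : (in_≺(f_1),…,in_≺(f_r))) equals in_≺(I), then (I : (f_1,…,f_r)) = I. -/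
open MvPolynomial

/-- The leading exponent (exponent of the leading monomial) of a polynomial with respect to a
monomial order `ord` (junk value `0` if `f = 0`). -/
noncomputable def leadExp {σ K : Type*} [CommSemiring K] (ord : MonomialOrder σ)
    (f : MvPolynomial σ K) : σ →₀ ℕ :=
  ord.toSyn.symm (f.support.sup ord.toSyn)

/-- The leading monomial `in_≺(f)` of a polynomial `f`, as a monic monomial. -/
noncomputable def leadMonPoly {σ K : Type*} [CommSemiring K] (ord : MonomialOrder σ)
    (f : MvPolynomial σ K) : MvPolynomial σ K :=
  monomial (leadExp ord f) 1

/-- The initial ideal `in_≺(I)` of an ideal `I`, generated by the leading monomials of the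
nonzero elements of `I`. -/
noncomputable def initialIdeal {σ K : Type*} [CommSemiring K] (ord : MonomialOrder σ)
    (I : Ideal (MvPolynomial σ K)) : Ideal (MvPolynomial σ K) :=
  Ideal.span {p : MvPolynomial σ K | ∃ g ∈ I, g ≠ 0 ∧ p = leadMonPoly ord g}

/-- An exponent whose monomial lies in the initial ideal is the degree of an element of the ideal,
with any prescribed nonzero leading coefficient. -/
lemma exists_mem_degree_eq_of_monomial_mem_initialIdeal {σ K : Type*} [Field K]
    (ord : MonomialOrder σ) {I : Ideal (MvPolynomial σ K)} {d : σ →₀ ℕ}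
    (hd : monomial d (1 : K) ∈ initialIdeal ord I) {c : K} (hc : c ≠ 0) :
    ∃ p ∈ I, ord.degree p = d ∧ ord.leadingCoeff p = c := by
  classical
  have himage : {p : MvPolynomial σ K | ∃ g ∈ I, g ≠ 0 ∧ p = leadMonPoly ord g} =
      (fun e => monomial e (1 : K)) '' {e | ∃ g ∈ I, g ≠ 0 ∧ e = ord.degree g} := by
    ext p
    constructor
    · rintro ⟨g, hg, hg0, rfl⟩
      exact ⟨_, ⟨g, hg, hg0, rfl⟩, rfl⟩
    · rintro ⟨_, ⟨g, hg, hg0, rfl⟩, rfl⟩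
      exact ⟨g, hg, hg0, rfl⟩
  rw [initialIdeal, himage, mem_ideal_span_monomial_image] at hd
  obtain ⟨_, ⟨g, hg, hg0, rfl⟩, hle⟩ := hd d (by simp [coeff_monomial])
  have hlc : ord.leadingCoeff g ≠ 0 := ord.leadingCoeff_ne_zero_iff.mpr hg0
  have hc' : c / ord.leadingCoeff g ≠ 0 := div_ne_zero hc hlc
  refine ⟨monomial (d - ord.degree g) (c / ord.leadingCoeff g) * g, I.mul_mem_left _ hg, ?_, ?_⟩
  · rw [ord.degree_mul (by simpa using hc') hg0, ord.degree_monomial, if_neg hc',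
      tsub_add_cancel_of_le hle]
  · rw [ord.leadingCoeff_mul, ord.leadingCoeff_monomial, div_mul_cancel₀ _ hlc]

/-- If `J` contains `I` and every leading monomial of a nonzero element of `J` lies in the initial
ideal of `I`, then `J ≤ I`. -/
lemma le_of_leadMonPoly_mem_initialIdeal {σ K : Type*} [Field K] (ord : MonomialOrder σ)
    {I J : Ideal (MvPolynomial σ K)} (hIJ : I ≤ J)
    (hJ : ∀ g ∈ J, g ≠ 0 → leadMonPoly ord g ∈ initialIdeal ord I) : J ≤ I := by
  intro g
  induction hn : ord.toSyn (ord.degree g) using WellFoundedLT.induction generalizing g with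
  | ind n ih =>
    intro hg
    by_cases hg0 : g = 0
    · simp [hg0]
    obtain ⟨p, hp, hdeg, hlc⟩ := exists_mem_degree_eq_of_monomial_mem_initialIdeal ord
      (hJ g hg hg0) (ord.leadingCoeff_ne_zero_iff.mpr hg0)
    change ord.degree p = ord.degree g at hdeg
    suffices hsub : g - p ∈ I by simpa using I.add_mem hsub hp
    by_cases hgp : g - p = 0
    · simp [hgp]
    refine ih _ ?_ rfl (J.sub_mem hg (hIJ hp))
    subst hn
    refine lt_of_le_of_ne (by simpa [hdeg] using ord.degree_sub_le (f := g) (g := p)) fun heq => ?_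
    apply ord.coeff_degree_ne_zero_iff.mpr hgp
    rw [ord.toSyn.injective heq, coeff_sub]
    rw [MonomialOrder.leadingCoeff, MonomialOrder.leadingCoeff, hdeg] at hlc
    rw [hlc, sub_self]

/-- The leading monomial is multiplicative on nonzero polynomials. -/
lemma leadMonPoly_mul {σ K : Type*} [CommSemiring K] [NoZeroDivisors K] (ord : MonomialOrder σ)
    {f g : MvPolynomial σ K} (hf : f ≠ 0) (hg : g ≠ 0) :
    leadMonPoly ord (f * g) = leadMonPoly ord f * leadMonPoly ord g := by
  have hdeg : leadExp ord (f * g) = leadExp ord f + leadExp ord g := ord.degree_mul hf hg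
  simp [leadMonPoly, hdeg, monomial_mul]

/-- Let `≺` be a monomial order on `S = K[t_1,…,t_s]`, let `I ⊆ S` be an
ideal, and let `f_1, …, f_r` be polynomials of `S` of positive degree.  If the colon ideal
`(in_≺(I) : (in_≺(f_1), …, in_≺(f_r)))` equals `in_≺(I)`, then `(I : (f_1, …, f_r)) = I`. -/
theorem stmt_4 {K : Type*} [Field K] {s r : ℕ} (ord : MonomialOrder (Fin s))
    (I : Ideal (MvPolynomial (Fin s) K)) (f : Fin r → MvPolynomial (Fin s) K)
    (hf : ∀ i, 0 < (f i).totalDegree)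
    (h : (initialIdeal ord I).colon
        (Ideal.span (Set.range fun i => leadMonPoly ord (f i))) = initialIdeal ord I) :
    I.colon (Ideal.span (Set.range f)) = I := by
  have hle : I ≤ I.colon (Ideal.span (Set.range f)) := Ideal.le_colon
  refine le_antisymm (le_of_leadMonPoly_mem_initialIdeal ord hle fun g hg hg0 => ?_) hle
  rw [← h, Ideal.span, Submodule.colon_span, Submodule.mem_colon]
  rintro _ ⟨i, rfl⟩
  have hfi : f i ≠ 0 := by
    intro h0
    simpa [h0] using hf i
  have hmem : g * f i ∈ I :=
    Submodule.mem_colon.mp hg _ (Ideal.subset_span (Set.mem_range_self i))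
  exact Ideal.subset_span ⟨_, hmem, mul_ne_zero hg0 hfi, (leadMonPoly_mul ord hg0 hfi).symm⟩
end

section
/- Let I ⊆ S be a graded ideal, let F = {f_1,…,f_r} be a finite set of nonzero homogeneous polynomials of S, and let ≺ be a monomial order on S. Then for every integer d ≥ 0 the graded components satisfy dim_K (S/(I + (F)))_d ≤ dim_K (S/(in_≺(I) + (in_≺(f_1),…,in_≺(f_r))))_d ≤ dim_K (S/I)_d. -/
open MvPolynomial

/-- The `K`-dimension of the degree-`d` graded component of `S/J` (for a graded ideal `J`),
realized as the image of the degree-`d` homogeneous component `S_d` in the quotient `S/J`. -/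
noncomputable def hilbertFn {K : Type*} [Field K] {s : ℕ}
    (J : Ideal (MvPolynomial (Fin s) K)) (d : ℕ) : ℕ :=
  Module.finrank K ((homogeneousSubmodule (Fin s) K d).map
    (Ideal.Quotient.mkₐ K J).toLinearMap)

/-- If every exponent of degree `d` outside `B` is the leading exponent of a form of degree `d`
in `J`, then the monomials with exponents in `B` span `(S/J)_d`. -/
lemma hilbertFn_le_card {K : Type*} [Field K] {s : ℕ} (ord : MonomialOrder (Fin s))
    (J : Ideal (MvPolynomial (Fin s) K)) (d : ℕ) (B : Finset (Fin s →₀ ℕ))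
    (hB : ∀ a : Fin s →₀ ℕ, a.degree = d → a ∉ B →
      ∃ g ∈ J, g ≠ 0 ∧ g.IsHomogeneous d ∧ ord.degree g = a) :
    hilbertFn J d ≤ B.card := by
  classical
  set φ := (Ideal.Quotient.mkₐ K J).toLinearMap
  have hφJ : ∀ g ∈ J, φ g = 0 := fun g hg => Ideal.Quotient.eq_zero_iff_mem.mpr hg
  set v : B → MvPolynomial (Fin s) K ⧸ J := fun b => φ (monomial b.1 1)
  have hmon : ∀ x : ord.syn, ∀ a : Fin s →₀ ℕ, ord.toSyn a = x → a.degree = d →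
      φ (monomial a 1) ∈ Submodule.span K (Set.range v) := by
    intro x
    induction x using WellFoundedLT.induction with
    | ind x ih =>
    rintro a rfl ha
    by_cases haB : a ∈ B
    · exact Submodule.subset_span ⟨⟨a, haB⟩, rfl⟩
    obtain ⟨g, hgJ, hg0, hgd, rfl⟩ := hB a ha haB
    have hsum : φ g = 0 := hφJ g hgJ
    have hterm : ∀ b : Fin s →₀ ℕ,
        φ (monomial b (g.coeff b)) = g.coeff b • φ (monomial b 1) := by
      intro b
      rw [← map_smul, smul_monomial, smul_eq_mul, mul_one]
    rw [g.as_sum, map_sum, ← Finset.add_sum_erase _ _ (ord.degree_mem_support hg0), hterm,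
      add_eq_zero_iff_eq_neg] at hsum
    rw [← Submodule.smul_mem_iff _ (ord.coeff_degree_ne_zero_iff.mpr hg0), hsum]
    refine Submodule.neg_mem _ (Submodule.sum_mem _ fun b hb => ?_)
    rw [hterm]
    obtain ⟨hne, hbs⟩ := Finset.mem_erase.mp hb
    refine Submodule.smul_mem _ _ (ih (ord.toSyn b) ?_ b rfl ?_)
    · exact lt_of_le_of_ne (ord.le_degree hbs) fun h => hne (ord.toSyn.injective h)
    · exact (hgd.degree_eq_sum_deg_support hbs).symm
  have hle : (homogeneousSubmodule (Fin s) K d).map φ ≤ Submodule.span K (Set.range v) := by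
    rintro _ ⟨p, hp, rfl⟩
    rw [p.as_sum, map_sum]
    refine Submodule.sum_mem _ fun b hb => ?_
    rw [← mul_one (p.coeff b), ← smul_eq_mul, ← smul_monomial, map_smul]
    exact Submodule.smul_mem _ _ (hmon _ b rfl
      (((mem_homogeneousSubmodule d p).mp hp).degree_eq_sum_deg_support hb).symm)
  have : Module.Finite K (Submodule.span K (Set.range v)) :=
    Module.Finite.span_of_finite K (Set.finite_range v)
  calc hilbertFn J d ≤ Module.finrank K (Submodule.span K (Set.range v)) :=
        Submodule.finrank_mono hle
    _ ≤ Fintype.card B := finrank_range_le_card v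
    _ = B.card := Fintype.card_coe B

/-- If no exponent in `B` is the leading exponent of a nonzero element of `J`, then the monomials
with exponents in `B` are linearly independent in `S/J`. -/
lemma card_le_hilbertFn {K : Type*} [Field K] {s : ℕ} (ord : MonomialOrder (Fin s))
    (J : Ideal (MvPolynomial (Fin s) K)) (d : ℕ) (B : Finset (Fin s →₀ ℕ))
    (hBd : ∀ a ∈ B, a.degree = d)
    (hB : ∀ g ∈ J, g ≠ 0 → ord.degree g ∉ B) :
    B.card ≤ hilbertFn J d := by
  set φ := (Ideal.Quotient.mkₐ K J).toLinearMap
  set v : B → MvPolynomial (Fin s) K := fun b => monomial b.1 1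
  have hv : LinearIndependent K v :=
    (basisMonomials (Fin s) K).linearIndependent.comp _ Subtype.val_injective
  have hspan : Submodule.span K (Set.range v) ≤ restrictSupport K (B : Set (Fin s →₀ ℕ)) := by
    rw [Submodule.span_le]
    rintro _ ⟨b, rfl⟩
    exact (monomial_mem_restrictSupport K).mpr (Or.inl b.2)
  have hφv : LinearIndependent K (φ ∘ v) := by
    refine hv.map (Submodule.disjoint_def.mpr fun g hg hgJ => ?_)
    by_contra hg0
    exact hB g (Ideal.Quotient.eq_zero_iff_mem.mp hgJ) hg0
      ((mem_restrictSupport_iff K).mp (hspan hg) (ord.degree_mem_support hg0))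
  have hle : Submodule.span K (Set.range (φ ∘ v)) ≤
      (homogeneousSubmodule (Fin s) K d).map φ := by
    rw [Submodule.span_le]
    rintro _ ⟨b, rfl⟩
    exact ⟨v b, isHomogeneous_monomial 1 (hBd b b.2), rfl⟩
  have : Module.Finite K ((homogeneousSubmodule (Fin s) K d).map φ) :=
    Module.Finite.iff_fg.mpr ((homogeneousSubmodule_fg (Fin s) K d).map φ)
  calc B.card = Fintype.card B := (Fintype.card_coe B).symm
    _ = Module.finrank K (Submodule.span K (Set.range (φ ∘ v))) :=
        (finrank_span_eq_card hφv).symm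
    _ ≤ hilbertFn J d := Submodule.finrank_mono hle

/-- An exponent divisible by the leading exponent of a nonzero element of an ideal generated by
homogeneous polynomials is itself the leading exponent of a homogeneous element of the ideal. -/
lemma exists_isHomogeneous_degree_eq {σ K : Type*} [Field K] (ord : MonomialOrder σ)
    {G : Set (MvPolynomial σ K)} (hG : ∀ g ∈ G, ∃ e, g.IsHomogeneous e)
    {g : MvPolynomial σ K} (hg : g ∈ Ideal.span G) (hg0 : g ≠ 0)
    {a : σ →₀ ℕ} (hga : ord.degree g ≤ a) :
    ∃ h ∈ Ideal.span G, h ≠ 0 ∧ h.IsHomogeneous a.degree ∧ ord.degree h = a := by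
  classical
  let _ : GradedAlgebra (homogeneousSubmodule σ K) := MvPolynomial.gradedAlgebra
  have hJ : (Ideal.span G).IsHomogeneous (homogeneousSubmodule σ K) :=
    Ideal.homogeneous_span _ _ fun g hg =>
      (hG g hg).imp fun e he => (mem_homogeneousSubmodule e g).mpr he
  set p := monomial (a - ord.degree g) (1 : K) * g with hp
  have hm0 : monomial (a - ord.degree g) (1 : K) ≠ 0 := by simp
  have hp0 : p ≠ 0 := mul_ne_zero hm0 hg0
  have hpa : ord.degree p = a := by
    rw [hp, ord.degree_mul hm0 hg0, ord.degree_monomial, if_neg one_ne_zero,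
      tsub_add_cancel_of_le hga]
  have hcoeff : coeff a (homogeneousComponent a.degree p) ≠ 0 := by
    rw [coeff_homogeneousComponent, if_pos rfl, ← hpa]
    exact ord.coeff_degree_ne_zero_iff.mpr hp0
  refine ⟨homogeneousComponent a.degree p,
    homogeneousComponent_mem_of_mem hJ (Ideal.mul_mem_left _ _ hg) _,
    fun h => hcoeff (by rw [h, coeff_zero]), homogeneousComponent_isHomogeneous _ _, ?_⟩
  apply ord.toSyn.injective
  apply le_antisymm
  · rw [← hpa]
    apply ord.degree_le_degree_of_support_subset
    rw [support_homogeneousComponent]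
    exact Finset.filter_subset _ _
  · exact ord.le_degree (mem_support_iff.mpr hcoeff)

/-- Let `I ⊆ S` be a graded ideal (an ideal generated by homogeneous
polynomials), let `F = {f_1, …, f_r}` be a finite set of nonzero homogeneous polynomials of
`S`, and let `≺` be a monomial order on `S`.  Then for every `d ≥ 0` the graded components
satisfy
`dim_K (S/(I + (F)))_d ≤ dim_K (S/(in_≺(I) + (in_≺ f_1, …, in_≺ f_r)))_d ≤ dim_K (S/I)_d`. -/
theorem stmt_5 {K : Type*} [Field K] {s r : ℕ} (ord : MonomialOrder (Fin s))
    (I : Ideal (MvPolynomial (Fin s) K))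
    (hI : ∃ G : Set (MvPolynomial (Fin s) K),
      (∀ g ∈ G, ∃ e, g.IsHomogeneous e) ∧ I = Ideal.span G)
    (f : Fin r → MvPolynomial (Fin s) K) (hf0 : ∀ i, f i ≠ 0)
    (hfh : ∀ i, ∃ e, (f i).IsHomogeneous e) :
    ∀ d : ℕ,
      hilbertFn (I + Ideal.span (Set.range f)) d ≤
        hilbertFn (initialIdeal ord I +
          Ideal.span (Set.range fun i => leadMonPoly ord (f i))) d ∧
      hilbertFn (initialIdeal ord I +
          Ideal.span (Set.range fun i => leadMonPoly ord (f i))) d ≤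
        hilbertFn I d := by
  classical
  intro d
  obtain ⟨G, hG, rfl⟩ := hI
  set I := Ideal.span G
  set M := initialIdeal ord I + Ideal.span (Set.range fun i => leadMonPoly ord (f i))
  set A : Set (Fin s →₀ ℕ) :=
    {a | ∃ g ∈ I + Ideal.span (Set.range f), g ≠ 0 ∧ ord.degree g = a ∧ monomial a 1 ∈ M}
  have hMA : M = Ideal.span ((fun a => monomial a (1 : K)) '' A) := by
    apply le_antisymm
    · refine sup_le (Ideal.span_le.mpr ?_) (Ideal.span_le.mpr ?_)
      · rintro _ ⟨g, hg, hg0, rfl⟩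
        exact Ideal.subset_span ⟨_, ⟨g, Ideal.mem_sup_left hg, hg0, rfl,
          Ideal.mem_sup_left (Ideal.subset_span ⟨g, hg, hg0, rfl⟩)⟩, rfl⟩
      · rintro _ ⟨i, rfl⟩
        exact Ideal.subset_span ⟨_, ⟨f i, Ideal.mem_sup_right (Ideal.subset_span ⟨i, rfl⟩),
          hf0 i, rfl, Ideal.mem_sup_right (Ideal.subset_span ⟨i, rfl⟩)⟩, rfl⟩
    · rw [Ideal.span_le]
      rintro _ ⟨a, ⟨_, _, _, _, ha⟩, rfl⟩
      exact ha
  have hfin : {a : Fin s →₀ ℕ | a.degree = d ∧ monomial a (1 : K) ∉ M}.Finite :=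
    (Finsupp.finite_of_degree_le d).subset fun a ha => ha.1.le
  set B := hfin.toFinset
  have hmemB : ∀ a, a ∈ B ↔ a.degree = d ∧ monomial a (1 : K) ∉ M := fun a => hfin.mem_toFinset
  have hBd : ∀ a ∈ B, a.degree = d := fun a ha => ((hmemB a).mp ha).1
  constructor
  · refine (hilbertFn_le_card ord _ d B fun a had haB => ?_).trans
      (card_le_hilbertFn ord M d B hBd fun g hg hg0 hgB => ((hmemB _).mp hgB).2 ?_)
    · have haM : monomial a (1 : K) ∈ M := by
        by_contra h
        exact haB ((hmemB a).mpr ⟨had, h⟩)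
      rw [hMA, mem_ideal_span_monomial_image] at haM
      obtain ⟨_, ⟨g, hg, hg0, rfl, _⟩, hga⟩ := haM a (by simp)
      have hspan : I + Ideal.span (Set.range f) = Ideal.span (G ∪ Set.range f) :=
        (Submodule.span_union _ _).symm
      rw [hspan] at hg ⊢
      exact had ▸ exists_isHomogeneous_degree_eq ord
        (by rintro g (h | ⟨i, rfl⟩); exacts [hG g h, hfh i]) hg hg0 hga
    · rw [hMA, mem_ideal_span_monomial_image] at hg ⊢
      intro b hb
      rw [Finset.mem_singleton.mp (support_monomial_subset hb)]
      exact hg _ (ord.degree_mem_support hg0)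
  · refine (hilbertFn_le_card ord M d B fun a had haB => ?_).trans
      (card_le_hilbertFn ord I d B hBd fun g hg hg0 hgB => ((hmemB _).mp hgB).2 ?_)
    · refine ⟨monomial a 1, ?_, by simp, isHomogeneous_monomial 1 had, ?_⟩
      · by_contra h
        exact haB ((hmemB a).mpr ⟨had, h⟩)
      · rw [ord.degree_monomial, if_neg one_ne_zero]
    · exact Ideal.mem_sup_left (Ideal.subset_span ⟨g, hg, hg0, rfl⟩)
end

section
/- Let X = [A_1×⋯×A_s] ⊆ ℙ^{s−1} be a projective nested cartesian set over F_q with d_i = |A_i|, let d be an integer with 1 ≤ d ≤ Σ_{i=1}^{s−1}(d_i − 1), let g ∈ F_q[t_1,…,t_s] be a homogeneous polynomial of degree d, and let [P] be a point of X. If g vanishes at every point of X ∖ {[P]}, then g(P) = 0. -/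
open MvPolynomial Finset

/-- The polynomial `∏ i, ∏ a ∈ B i, (X i - a)` has coefficient `1` at its top monomial. -/
theorem coeff_prod_prod_X_sub_C {K σ : Type*} [Field K] [Fintype σ] (B : σ → Finset K) :
    coeff (Finsupp.equivFunOnFinite.symm fun i => #(B i))
      (∏ i, ∏ a ∈ B i, (X i - C a : MvPolynomial σ K)) = 1 := by
  classical
  let _ : LinearOrder σ := WellOrderingRel.isWellOrder.linearOrder
  let m : MonomialOrder σ := MonomialOrder.lex
  have hmonic : ∀ i, m.Monic (∏ a ∈ B i, (X i - C a : MvPolynomial σ K)) := fun i =>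
    MonomialOrder.Monic.prod fun a _ => m.monic_X_sub_C i a
  have hdeg : m.degree (∏ i, ∏ a ∈ B i, (X i - C a : MvPolynomial σ K)) =
      Finsupp.equivFunOnFinite.symm fun i => #(B i) := by
    rw [MonomialOrder.degree_prod fun i _ => (hmonic i).ne_zero]
    ext j
    rw [Finsupp.finsetSum_apply, Finset.sum_eq_single j]
    · rw [MonomialOrder.degree_prod fun a _ => (m.monic_X_sub_C j a).ne_zero]
      simp [MonomialOrder.degree_X_sub_C]
    · intro i _ hij
      rw [MonomialOrder.degree_prod fun a _ => (m.monic_X_sub_C i a).ne_zero]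
      simp [MonomialOrder.degree_X_sub_C, hij]
    · simp
  rw [← hdeg]
  exact MonomialOrder.Monic.prod fun i _ => hmonic i

theorem totalDegree_prod_prod_X_sub_C_le {K σ : Type*} [Field K] [Fintype σ]
    (B : σ → Finset K) :
    (∏ i, ∏ a ∈ B i, (X i - C a : MvPolynomial σ K)).totalDegree ≤ ∑ i, #(B i) := by
  refine (totalDegree_finsetProd _ _).trans (Finset.sum_le_sum fun i _ => ?_)
  refine (totalDegree_finsetProd _ _).trans ?_
  rw [Finset.card_eq_sum_ones]
  refine Finset.sum_le_sum fun a _ => ?_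
  exact (totalDegree_sub_C_le _ _).trans (totalDegree_X i).le

/-- A polynomial of degree at most `∑ i, (|S i| - 1)` vanishing at all points but one of the grid
`∏ i, S i` has a nonzero coefficient at `∏ i, X i ^ (|S i| - 1)`. -/
theorem coeff_ne_zero_of_eval_ne_zero_at_unique {K σ : Type*} [Field K] [Fintype σ]
    (S : σ → Finset K) (f : MvPolynomial σ K) (hf : f.totalDegree ≤ ∑ i, (#(S i) - 1))
    (p : σ → K) (hp : ∀ i, p i ∈ S i) (hfp : eval p f ≠ 0)
    (hvan : ∀ v : σ → K, (∀ i, v i ∈ S i) → v ≠ p → eval v f = 0) :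
    coeff (Finsupp.equivFunOnFinite.symm fun i => #(S i) - 1) f ≠ 0 := by
  classical
  intro hcoeff
  let B : σ → Finset K := fun i => (S i).erase (p i)
  have hB : ∀ i, #(B i) = #(S i) - 1 := fun i => Finset.card_erase_of_mem (hp i)
  set Q : MvPolynomial σ K := ∏ i, ∏ a ∈ B i, (X i - C a) with hQ
  have hQcoeff : coeff (Finsupp.equivFunOnFinite.symm fun i => #(S i) - 1) Q = 1 := by
    simpa only [hB] using coeff_prod_prod_X_sub_C B
  have hQdeg : Q.totalDegree ≤ ∑ i, (#(S i) - 1) := by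
    simpa only [hB] using totalDegree_prod_prod_X_sub_C_le B
  have hQeval : ∀ v, eval v Q = ∏ i, ∏ a ∈ B i, (v i - a) := fun v => by simp [hQ]
  have hQp : eval p Q ≠ 0 := by
    rw [hQeval, Finset.prod_ne_zero_iff]
    intro i _
    rw [Finset.prod_ne_zero_iff]
    exact fun a ha => sub_ne_zero.2 (Finset.ne_of_mem_erase ha).symm
  have hQvan : ∀ v : σ → K, (∀ i, v i ∈ S i) → v ≠ p → eval v Q = 0 := by
    intro v hv hne
    obtain ⟨i, hi⟩ := Function.ne_iff.1 hne
    rw [hQeval]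
    exact Finset.prod_eq_zero (Finset.mem_univ i)
      (Finset.prod_eq_zero (Finset.mem_erase.2 ⟨hi, hv i⟩) (sub_self _))
  let F : MvPolynomial σ K := C (eval p Q) * f - C (eval p f) * Q
  have hFcoeff : coeff (Finsupp.equivFunOnFinite.symm fun i => #(S i) - 1) F ≠ 0 := by
    simpa [F, coeff_C_mul, hcoeff, hQcoeff] using hfp
  have hmdeg : (Finsupp.equivFunOnFinite.symm fun i => #(S i) - 1).degree =
      ∑ i, (#(S i) - 1) := by
    simp [Finsupp.degree_eq_sum]
  have hFdeg : F.totalDegree = (Finsupp.equivFunOnFinite.symm fun i => #(S i) - 1).degree := by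
    refine le_antisymm ?_ (le_totalDegree (mem_support_iff.2 hFcoeff))
    rw [hmdeg]
    refine (totalDegree_sub _ _).trans (max_le ?_ ?_)
    · exact (totalDegree_mul _ _).trans (by simpa using hf)
    · exact (totalDegree_mul _ _).trans (by simpa using hQdeg)
  obtain ⟨v, hv, hne⟩ := combinatorial_nullstellensatz_exists_eval_nonzero F _ hFcoeff hFdeg S
    fun i => Nat.sub_lt (Finset.card_pos.2 ⟨p i, hp i⟩) one_pos
  apply hne
  by_cases hvp : v = p
  · subst hvp
    simp [F, mul_comm]
  · simp [F, hvan v hv hvp, hQvan v hv hvp]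

/-- Let `X = [A_1 × ⋯ × A_s] ⊆ ℙ^{s-1}` be a projective nested cartesian set
over a finite field (here `s = n + 1`, the sets `A_i` contain `0` and `1`, are closed under
the division condition, and their cardinalities `d_i = |A_i|` are nondecreasing).
Let `1 ≤ d ≤ Σ_{i=1}^{s-1} (d_i − 1)`, let `g` be homogeneous of degree `d`, and let `[P]` be a
point of `X` (with representative `P` in the cartesian product).  If `g` vanishes at every
point of `X ∖ {[P]}` (i.e. at every representative `v` in the cartesian product that is not a
scalar multiple of `P`), then `g(P) = 0`. -/
theorem stmt_6 {K : Type*} [Field K] [Fintype K] {n : ℕ}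
    (A : Fin (n + 1) → Finset K)
    (h0 : ∀ i, (0 : K) ∈ A i) (h1 : ∀ i, (1 : K) ∈ A i)
    (hdiv : ∀ i j : Fin (n + 1), i < j → ∀ a ∈ A j, ∀ b ∈ A i, b ≠ 0 → a / b ∈ A j)
    (hmono : ∀ i j : Fin (n + 1), i ≤ j → (A i).card ≤ (A j).card)
    (g : MvPolynomial (Fin (n + 1)) K) (d : ℕ)
    (hg : g.IsHomogeneous d) (hd1 : 1 ≤ d)
    (hd2 : d ≤ ∑ i ∈ univ.filter (fun i : Fin (n + 1) => i.val < n), ((A i).card - 1))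
    (P : Fin (n + 1) → K) (hP0 : P ≠ 0) (hPA : ∀ i, P i ∈ A i)
    (hvan : ∀ v : Fin (n + 1) → K, v ≠ 0 → (∀ i, v i ∈ A i) →
      (¬ ∃ c : K, v = c • P) → eval v g = 0) :
    eval P g = 0 := by
  classical
  by_contra hgP
  obtain ⟨k, hk⟩ := Function.ne_iff.1 hP0
  let S : K → Fin (n + 1) → Finset K := fun c => Function.update A k {c}
  have hScard : ∀ c i, #(S c i) - 1 = if i = k then 0 else #(A i) - 1 := by
    intro c i
    by_cases hi : i = k
    · subst hi
      simp [S]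
    · simp [S, hi]
  have hSA : ∀ c ∈ A k, ∀ v : Fin (n + 1) → K, (∀ i, v i ∈ S c i) →
      v k = c ∧ ∀ i, v i ∈ A i := by
    intro c hc v hv
    have hvk : v k = c := by simpa [S] using hv k
    refine ⟨hvk, fun i => ?_⟩
    by_cases hi : i = k
    · subst hi
      rwa [hvk]
    · simpa [S, hi] using hv i
  have hsum : d ≤ ∑ i, (#(S (P k) i) - 1) := by
    have hfilter : (univ.filter fun i : Fin (n + 1) => i.val < n) = univ.erase (Fin.last n) := by
      ext i
      simp [← Fin.val_ne_iff]
      omega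
    have hlast := Finset.sum_erase_add univ (fun i => #(A i) - 1) (mem_univ (Fin.last n))
    have hsk := Finset.sum_erase_add univ (fun i => #(A i) - 1) (mem_univ k)
    have hS : ∑ i, (#(S (P k) i) - 1) = ∑ i ∈ univ.erase k, (#(A i) - 1) := by
      rw [← Finset.sum_erase univ (a := k) (by simp [hScard])]
      refine Finset.sum_congr rfl fun i hi => ?_
      rw [hScard, if_neg (Finset.ne_of_mem_erase hi)]
    have hle := hmono k (Fin.last n) (Fin.le_last k)
    rw [hfilter] at hd2
    rw [hS]
    omega
  have hcoeff := coeff_ne_zero_of_eval_ne_zero_at_unique (S (P k)) g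
    (hg.totalDegree_le.trans hsum) P
    (fun i => by
      by_cases hi : i = k
      · subst hi
        simp [S]
      · simpa [S, hi] using hPA i) hgP
    (fun v hv hne => by
      obtain ⟨hvk, hvA⟩ := hSA _ (hPA k) v hv
      refine hvan v (fun h => hk ?_) hvA ?_
      · rw [← hvk, h]
      · rintro ⟨c, rfl⟩
        have hc : c = 1 := mul_right_cancel₀ hk (by simpa using hvk)
        exact hne (by rw [hc, one_smul]))
  obtain ⟨v, hv, hne⟩ := combinatorial_nullstellensatz_exists_eval_nonzero g _ hcoeff
    (by rw [hg.totalDegree (fun h => hgP (by simp [h])), Finsupp.degree_eq_weight_one]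
        exact (hg hcoeff).symm) (S 0)
    (fun i => by
      have hpos : 0 < #(S 0 i) := by
        by_cases hi : i = k
        · subst hi
          simp [S]
        · simpa [S, hi] using ⟨0, h0 i⟩
      have h := (hScard 0 i).trans (hScard (P k) i).symm
      simp only [Finsupp.equivFunOnFinite_symm_apply_apply]
      omega)
  obtain ⟨hvk, hvA⟩ := hSA 0 (h0 k) v hv
  apply hne
  by_cases hv0 : v = 0
  · rw [hv0, eval_zero, constantCoeff_eq]
    exact hg.coeff_eq_zero (by simp; omega)
  · refine hvan v hv0 hvA ?_
    rintro ⟨c, rfl⟩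
    have hc : c = 0 := by simpa [show P k ≠ 0 from hk] using hvk
    exact hv0 (by rw [hc, zero_smul])
end

section
/- Let a = (a_1,…,a_m) and b = (b_1,…,b_m) be sequences of positive integers and let r < s be indices in {1,…,m} with a_r > a_s. Define a' by a'_r = a_s, a'_s = a_r and a'_i = a_i for i ≠ r,s, and define b' by b'_r = min(b_r,b_s), b'_s = max(b_r,b_s) and b'_i = b_i for i ≠ r,s. Then π(a,b) ≥ π(a',b'). -/
/-- For sequences `a, b` of (positive) integers,
`π(a,b) := ∏ a_i + ∏ b_i − ∏ min(a_i, b_i)` (as an integer). -/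
def piInt {m : ℕ} (a b : Fin m → ℕ) : ℤ :=
  (∏ i, (a i : ℤ)) + (∏ i, (b i : ℤ)) - ∏ i, (min (a i) (b i) : ℤ)

theorem prod_eq_mul_mul_prod_erase_erase {ι M : Type*} [Fintype ι] [DecidableEq ι] [CommMonoid M]
    (f : ι → M) {r s : ι} (hrs : r ≠ s) :
    ∏ i, f i = f r * f s * ∏ i ∈ (Finset.univ.erase r).erase s, f i := by
  rw [mul_assoc, Finset.mul_prod_erase _ f (by simp [hrs.symm]),
    Finset.mul_prod_erase _ f (Finset.mem_univ r)]

/-- Sorting both pairs the same way does not decrease the product of the pairwise minima. -/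
theorem min_mul_min_le_min_mul_min_of_lt {x y p q : ℤ} (hx : 0 ≤ x) (hp : 0 ≤ p)
    (hxy : x < y) :
    min y p * min x q ≤ min x (min p q) * min y (max p q) := by
  rcases le_total p q with h | h
  · rw [min_eq_left h, max_eq_right h]
    rcases le_total p x with h1 | h1
    · rw [min_eq_right h1, min_eq_right (h1.trans hxy.le)]
      gcongr
    · rw [min_eq_left h1, min_eq_left (h1.trans h), mul_comm]
      gcongr
  · rw [min_eq_right h, max_eq_left h, mul_comm]

/-- Let `a, b` be sequences of positive integers and `r < s` indices with
`a_r > a_s`.  Define `a'` by swapping the `r`-th and `s`-th entries of `a`, and `b'` by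
replacing `b_r, b_s` with `min(b_r,b_s), max(b_r,b_s)`.  Then `π(a,b) ≥ π(a',b')`. -/
theorem stmt_9 {m : ℕ} (a b : Fin m → ℕ) (ha : ∀ i, 0 < a i) (hb : ∀ i, 0 < b i)
    (r s : Fin m) (hrs : r < s) (hars : a s < a r) :
    piInt (fun i => if i = r then a s else if i = s then a r else a i)
        (fun i => if i = r then min (b r) (b s) else if i = s then max (b r) (b s) else b i) ≤
      piInt a b := by
  have hne : r ≠ s := hrs.ne
  unfold piInt
  simp only [prod_eq_mul_mul_prod_erase_erase _ hne, if_true, if_neg hne.symm]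
  have hrest : ∀ (g : ℕ → ℕ → ℤ),
      ∏ i ∈ (Finset.univ.erase r).erase s,
        g (if i = r then a s else if i = s then a r else a i)
          (if i = r then min (b r) (b s) else if i = s then max (b r) (b s) else b i) =
      ∏ i ∈ (Finset.univ.erase r).erase s, g (a i) (b i) := fun g =>
    Finset.prod_congr rfl fun i hi => by
      simp only [Finset.mem_erase] at hi
      simp only [if_neg hi.1, if_neg hi.2.1]
  rw [hrest fun x _ => (x : ℤ), hrest fun _ y => (y : ℤ), hrest fun x y => min (x : ℤ) y]
  have hmin := mul_le_mul_of_nonneg_right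
    (min_mul_min_le_min_mul_min_of_lt (x := a s) (y := a r) (p := b r) (q := b s)
      (by positivity) (by positivity) (by exact_mod_cast hars))
    (Finset.prod_nonneg fun i (_ : i ∈ (Finset.univ.erase r).erase s) =>
      le_min (Int.natCast_nonneg (a i)) (Int.natCast_nonneg (b i)))
  push_cast
  rw [min_mul_max, mul_comm (a s : ℤ)]
  linarith
end

section
/- Let a = (a_1,…,a_m) and b = (b_1,…,b_m) be sequences of positive integers and let r < s be indices in {1,…,m} with b_r = a_r ≤ a_s < b_s. Define a' by a'_r = a_r − 1, a'_s = a_s + 1 and a'_i = a_i for i ≠ r,s. Then π(a,b) ≥ π(a',b). -/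
/-- Let `a, b` be sequences of positive integers and `r < s` indices with
`b_r = a_r ≤ a_s < b_s`.  Define `a'` by `a'_r = a_r − 1`, `a'_s = a_s + 1` and `a'_i = a_i`
otherwise.  Then `π(a,b) ≥ π(a',b)`. -/
theorem stmt_10 {m : ℕ} (a b : Fin m → ℕ) (ha : ∀ i, 0 < a i) (hb : ∀ i, 0 < b i)
    (r s : Fin m) (hrs : r < s) (h1 : b r = a r) (h2 : a r ≤ a s) (h3 : a s < b s) :
    piInt (fun i => if i = r then a r - 1 else if i = s then a s + 1 else a i) b ≤
      piInt a b := by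
  have hne : r ≠ s := hrs.ne
  set R := (Finset.univ.erase r).erase s with hR
  set a' : Fin m → ℕ := fun i => if i = r then a r - 1 else if i = s then a s + 1 else a i with ha'
  have hr : (a' r : ℤ) = a r - 1 := by
    have := ha r
    simp only [ha', if_true]
    omega
  have hs : (a' s : ℤ) = a s + 1 := by simp [ha', hne.symm]
  have hrest : ∀ i ∈ R, a' i = a i := fun i hi => by
    simp only [hR, Finset.mem_erase] at hi
    simp [ha', hi.1, hi.2.1]
  have hP : ∏ i ∈ R, (a' i : ℤ) = ∏ i ∈ R, (a i : ℤ) :=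
    Finset.prod_congr rfl fun i hi => by rw [hrest i hi]
  have hQ : ∏ i ∈ R, (min (a' i) (b i) : ℤ) = ∏ i ∈ R, (min (a i) (b i) : ℤ) :=
    Finset.prod_congr rfl fun i hi => by rw [hrest i hi]
  have hQP : ∏ i ∈ R, (min (a i) (b i) : ℤ) ≤ ∏ i ∈ R, (a i : ℤ) :=
    Finset.prod_le_prod (fun i _ => by positivity) fun i _ => min_le_left _ _
  have hmr : min (a r : ℤ) (b r) = a r := by rw [h1, min_self]
  have hms : min (a s : ℤ) (b s) = a s := min_eq_left (by omega)
  have hmr' : min (a' r : ℤ) (b r) = a r - 1 := by rw [hr, h1]; exact min_eq_left (by omega)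
  have hms' : min (a' s : ℤ) (b s) = a s + 1 := by rw [hs]; exact min_eq_left (by omega)
  unfold piInt
  rw [prod_eq_mul_mul_prod_erase_erase (fun i => (a' i : ℤ)) hne,
    prod_eq_mul_mul_prod_erase_erase (fun i => (a i : ℤ)) hne,
    prod_eq_mul_mul_prod_erase_erase (fun i => min (a' i : ℤ) (b i)) hne,
    prod_eq_mul_mul_prod_erase_erase (fun i => min (a i : ℤ) (b i)) hne]
  rw [← hR, hP, hQ, hmr, hms, hmr', hms', hr, hs]
  have hcoef : (a r - 1 : ℤ) * (a s + 1) ≤ a r * a s := by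
    have : (a r : ℤ) ≤ a s := by exact_mod_cast h2
    linarith
  linarith [mul_le_mul_of_nonneg_right hcoef (sub_nonneg.2 hQP)]
end

section
/- Let a = (a_1,…,a_m) and b = (b_1,…,b_m) be sequences of positive integers and let r < s be indices in {1,…,m} with b_r < a_r ≤ a_s. Define a' by a'_r = a_r − 1, a'_s = a_s + 1 and a'_i = a_i for i ≠ r,s. Then π(a,b) ≥ π(a',b). -/
/-- Let `a, b` be sequences of positive integers and `r < s` indices with
`b_r < a_r ≤ a_s`.  Define `a'` by `a'_r = a_r − 1`, `a'_s = a_s + 1` and `a'_i = a_i`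
otherwise.  Then `π(a,b) ≥ π(a',b)`. -/
theorem stmt_11 {m : ℕ} (a b : Fin m → ℕ) (ha : ∀ i, 0 < a i) (hb : ∀ i, 0 < b i)
    (r s : Fin m) (hrs : r < s) (h1 : b r < a r) (h2 : a r ≤ a s) :
    piInt (fun i => if i = r then a r - 1 else if i = s then a s + 1 else a i) b ≤
      piInt a b := by
  have hsr : s ∈ Finset.univ.erase r := by simp [hrs.ne']
  have split : ∀ f : Fin m → ℤ,
      ∏ i, f i = f r * (f s * ∏ i ∈ (Finset.univ.erase r).erase s, f i) := fun f => by
    rw [Finset.mul_prod_erase _ _ hsr, Finset.mul_prod_erase _ _ (Finset.mem_univ r)]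
  have hprod : ∏ i, ((if i = r then a r - 1 else if i = s then a s + 1 else a i : ℕ) : ℤ) ≤
      ∏ i, (a i : ℤ) := by
    rw [split, split (fun i => (a i : ℤ))]
    have hrest : ∏ i ∈ (Finset.univ.erase r).erase s,
        ((if i = r then a r - 1 else if i = s then a s + 1 else a i : ℕ) : ℤ) =
        ∏ i ∈ (Finset.univ.erase r).erase s, (a i : ℤ) := by
      refine Finset.prod_congr rfl fun i hi => ?_
      simp only [Finset.mem_erase] at hi
      rw [if_neg hi.2.1, if_neg hi.1]
    rw [hrest, if_pos rfl, if_neg hrs.ne', if_pos rfl, ← mul_assoc, ← mul_assoc,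
      Nat.cast_sub (ha r)]
    refine mul_le_mul_of_nonneg_right ?_ (Finset.prod_nonneg fun i _ => by positivity)
    have : (a r : ℤ) ≤ a s := by exact_mod_cast h2
    push_cast
    linarith
  have hmin : ∏ i, min (a i : ℤ) (b i) ≤
      ∏ i, min ((if i = r then a r - 1 else if i = s then a s + 1 else a i : ℕ) : ℤ) (b i) := by
    refine Finset.prod_le_prod (fun i _ => by positivity) fun i _ => ?_
    split_ifs with hr hs
    · subst hr
      omega
    · subst hs
      omega
    · exact le_rfl
  unfold piInt
  linarith
end

section
/- Let m ≥ 2 and let 1 ≤ e_1 ≤ ⋯ ≤ e_m be integers. Let 1 ≤ r ≤ m−1 and set s = r+1. Let a = (a_1,…,a_m) and b = (b_1,…,b_m) be integer sequences with 1 ≤ a_i ≤ e_i and 1 ≤ b_i ≤ e_i for all i, such that: a_i = b_i = 1 for i < r; a_i = b_i = e_i for i > s; a_r + a_s = b_r + b_s; (a_r,a_s) ≠ (b_r,b_s); b_r ≤ a_s; and b_s = a_s − 1. Then for every k = 1,…,m−1: π(a,b) ≥ (Σ_{i=1}^m a_i − Σ_{i=k+1}^m e_i − (k−2))·e_{k+1}⋯e_m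 − e_{k+2}⋯e_m, where the empty product e_{k+2}⋯e_m equals 1 when k = m−1. -/
open Finset

/-- Peeling off the first factor of a tail product. -/
lemma prod_filter_le_succ {m : ℕ} (g : Fin m → ℤ) (j : Fin m) :
    ∏ i ∈ univ.filter (fun i : Fin m => j.val ≤ i.val), g i =
      g j * ∏ i ∈ univ.filter (fun i : Fin m => j.val + 1 ≤ i.val), g i := by
  have h : univ.filter (fun i : Fin m => j.val ≤ i.val) =
      insert j (univ.filter (fun i : Fin m => j.val + 1 ≤ i.val)) := by
    ext i
    simp only [mem_filter, mem_univ, true_and, mem_insert, Fin.ext_iff]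
    omega
  rw [h, prod_insert (by simp)]

/-- Peeling off the first summand of a tail sum. -/
lemma sum_filter_le_succ {m : ℕ} (g : Fin m → ℤ) (j : Fin m) :
    ∑ i ∈ univ.filter (fun i : Fin m => j.val ≤ i.val), g i =
      g j + ∑ i ∈ univ.filter (fun i : Fin m => j.val + 1 ≤ i.val), g i := by
  have h : univ.filter (fun i : Fin m => j.val ≤ i.val) =
      insert j (univ.filter (fun i : Fin m => j.val + 1 ≤ i.val)) := by
    ext i
    simp only [mem_filter, mem_univ, true_and, mem_insert, Fin.ext_iff]
    omega
  rw [h, sum_insert (by simp)]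

/-- A product whose factors are `1` before `r` and agree with `e` after `s = r + 1`. -/
lemma prod_eq_of_one_of_eq {m : ℕ} (g e : Fin m → ℤ) (r s : Fin m) (hs : s.val = r.val + 1)
    (hlow : ∀ i, i < r → g i = 1) (hhigh : ∀ i, s < i → g i = e i) :
    ∏ i, g i =
      g r * (g s * ∏ i ∈ univ.filter (fun i : Fin m => s.val + 1 ≤ i.val), e i) := by
  have h : ∏ i ∈ univ.filter (fun i : Fin m => r.val ≤ i.val), g i = ∏ i, g i := by
    apply prod_subset (subset_univ _)
    intro i _ hi
    apply hlow
    simpa using hi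
  rw [← h, prod_filter_le_succ, ← hs, prod_filter_le_succ]
  congr 2
  apply prod_congr rfl
  intro i hi
  apply hhigh
  simpa [Nat.succ_le_iff] using hi

/-- A sum whose terms are `1` before `r` and agree with `e` after `s = r + 1`. -/
lemma sum_eq_of_one_of_eq {m : ℕ} (g e : Fin m → ℤ) (r s : Fin m) (hs : s.val = r.val + 1)
    (hlow : ∀ i, i < r → g i = 1) (hhigh : ∀ i, s < i → g i = e i) :
    ∑ i, g i =
      r.val + g r + g s + ∑ i ∈ univ.filter (fun i : Fin m => s.val + 1 ≤ i.val), e i := by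
  rw [← sum_filter_add_sum_filter_not univ (fun i : Fin m => r.val ≤ i.val),
    sum_filter_le_succ, ← hs, sum_filter_le_succ]
  have h₁ : ∑ i ∈ univ.filter (fun i : Fin m => ¬ r.val ≤ i.val), g i = r.val := by
    have h : univ.filter (fun i : Fin m => ¬ r.val ≤ i.val) = Iio r := by
      ext i
      simp
    rw [h, sum_congr rfl fun i hi => hlow i (mem_Iio.1 hi)]
    simp
  have h₂ : ∑ i ∈ univ.filter (fun i : Fin m => s.val + 1 ≤ i.val), g i =
      ∑ i ∈ univ.filter (fun i : Fin m => s.val + 1 ≤ i.val), e i := by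
    apply sum_congr rfl
    intro i hi
    apply hhigh
    simpa [Nat.succ_le_iff] using hi
  rw [h₁, h₂]
  ring

/-- Going up from `p`, the tail-product expression weighted by the excess sum does not grow. -/
lemma tail_bound_of_ge {m p : ℕ} {T A E : ℕ → ℤ} {u B : ℤ}
    (hT : ∀ k, k < m → T k = E k * T (k + 1)) (hA : ∀ k, k < m → A k = E k + A (k + 1))
    (hE : ∀ k, k < m → 1 ≤ E k) (hpos : ∀ k, 0 ≤ T k) (hu : 1 ≤ u) (hbase : u * T p ≤ B)
    {k : ℕ} (hpk : p ≤ k) (hkm : k ≤ m) :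
    (u + A p - A k - (k - p)) * T k ≤ B := by
  suffices h : 1 ≤ u + A p - A k - (k - p) ∧ (u + A p - A k - (k - p)) * T k ≤ B from h.2
  induction k, hpk using Nat.le_induction with
  | base => simpa using ⟨hu, hbase⟩
  | succ k _ ih =>
    obtain ⟨ih₁, ih₂⟩ := ih (by omega)
    have h₁ := hT k (by omega)
    have h₂ := hA k (by omega)
    have h₃ := hE k (by omega)
    push_cast
    refine ⟨by linarith, le_trans ?_ ih₂⟩
    rw [h₁, ← mul_assoc]
    apply mul_le_mul_of_nonneg_right _ (hpos _)
    nlinarith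

/-- Going down from `p`, the weighted tail product cannot exceed a nonnegative bound. -/
lemma tail_bound_of_le {m p : ℕ} {T A E : ℕ → ℤ} {u B : ℤ}
    (hT : ∀ k, k < m → T k = E k * T (k + 1)) (hA : ∀ k, k < m → A k = E k + A (k + 1))
    (hE : ∀ k, k < m → 1 ≤ E k) (hpos : ∀ k, 0 ≤ T k) (hu : u ≤ 1) (hB : 0 ≤ B)
    (hbase : u * T p ≤ B) {k : ℕ} (hkp : k ≤ p) (hpm : p ≤ m) :
    (u + A p - A k + (p - k)) * T k ≤ B := by
  suffices h : u + A p - A k + (p - k) ≤ 1 ∧ (u + A p - A k + (p - k)) * T k ≤ B from h.2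
  induction hkp using Nat.decreasingInduction with
  | self => simpa using ⟨hu, hbase⟩
  | of_succ k hk ih =>
    obtain ⟨ih₁, ih₂⟩ := ih
    have h₁ := hT k (by omega)
    have h₂ := hA k (by omega)
    have h₃ := hE k (by omega)
    push_cast at ih₁ ih₂
    refine ⟨by linarith, ?_⟩
    rcases le_or_gt (u + A p - A k + (p - k)) 0 with h | h
    · exact (mul_nonpos_of_nonpos_of_nonneg h (hpos k)).trans hB
    · have h₄ : E k = 1 := by linarith
      rw [h₁, h₂, h₄, one_mul]
      convert ih₂ using 2
      ring

/-- Let `m ≥ 2` and `1 ≤ e_1 ≤ ⋯ ≤ e_m`.  Let `1 ≤ r ≤ m−1`, `s = r+1`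
(indices are `0`-based below, so `r` ranges over `Fin m` with `s.val = r.val + 1`), and let
`a, b` satisfy `1 ≤ a_i, b_i ≤ e_i`, `a_i = b_i = 1` for `i < r`, `a_i = b_i = e_i` for
`i > s`, `a_r + a_s = b_r + b_s`, `(a_r, a_s) ≠ (b_r, b_s)`, `b_r ≤ a_s`, `b_s = a_s − 1`.
Then for every `k = 1, …, m−1`,
`π(a,b) ≥ (Σ_i a_i − Σ_{i>k} e_i − (k−2)) · e_{k+1} ⋯ e_m − e_{k+2} ⋯ e_m`
(`1`-based products; the empty product is `1` when `k = m−1`). -/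
theorem stmt_13 {m : ℕ} (hm : 2 ≤ m) (e a b : Fin m → ℕ)
    (he1 : ∀ i, 1 ≤ e i) (hemono : ∀ i j : Fin m, i ≤ j → e i ≤ e j)
    (r s : Fin m) (hs : s.val = r.val + 1)
    (ha : ∀ i, 1 ≤ a i ∧ a i ≤ e i) (hb : ∀ i, 1 ≤ b i ∧ b i ≤ e i)
    (hlow : ∀ i, i < r → a i = 1 ∧ b i = 1)
    (hhigh : ∀ i, s < i → a i = e i ∧ b i = e i)
    (hsum : a r + a s = b r + b s)
    (hne : (a r, a s) ≠ (b r, b s))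
    (hbr : b r ≤ a s) (hbs : b s = a s - 1) :
    ∀ k : ℕ, 1 ≤ k → k ≤ m - 1 →
      ((∑ i, (a i : ℤ)) - (∑ i ∈ univ.filter (fun i : Fin m => k ≤ i.val), (e i : ℤ)) -
            ((k : ℤ) - 2)) *
          (∏ i ∈ univ.filter (fun i : Fin m => k ≤ i.val), (e i : ℤ)) -
        (∏ i ∈ univ.filter (fun i : Fin m => k + 1 ≤ i.val), (e i : ℤ)) ≤
      piInt a b := by
  intro k _ hk
  set T : ℕ → ℤ := fun k => ∏ i ∈ univ.filter (fun i : Fin m => k ≤ i.val), (e i : ℤ) with hTdef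
  set A : ℕ → ℤ := fun k => ∑ i ∈ univ.filter (fun i : Fin m => k ≤ i.val), (e i : ℤ)
  set E : ℕ → ℤ := fun k => if h : k < m then (e ⟨k, h⟩ : ℤ) else 1 with hEdef
  have hE : ∀ k, k < m → 1 ≤ E k := by
    intro k hk
    simp only [hEdef, hk, dif_pos]
    exact_mod_cast he1 _
  have hT : ∀ k, k < m → T k = E k * T (k + 1) := by
    intro k hk
    simp only [hEdef, hk, dif_pos]
    exact prod_filter_le_succ (fun i => (e i : ℤ)) ⟨k, hk⟩
  have hA : ∀ k, k < m → A k = E k + A (k + 1) := by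
    intro k hk
    simp only [hEdef, hk, dif_pos]
    exact sum_filter_le_succ (fun i => (e i : ℤ)) ⟨k, hk⟩
  have hpos : ∀ k, 0 ≤ T k := fun k => prod_nonneg fun i _ => by positivity
  have hEr : E r.val = e r := by simp [hEdef]
  have hEs : E s.val = e s := by simp [hEdef]
  have hTs : T s.val = e s * T (s.val + 1) := by rw [hT _ s.isLt, hEs]
  have hTr : T r.val = e r * (e s * T (s.val + 1)) := by rw [hT _ r.isLt, hEr, ← hs, hTs]
  have hAs : A s.val = e s + A (s.val + 1) := by rw [hA _ s.isLt, hEs]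
  have hAr : A r.val = e r + (e s + A (s.val + 1)) := by rw [hA _ r.isLt, hEr, ← hs, hAs]
  have has := (ha s).2
  have har := (ha r).1
  have hbs1 := (hb s).1
  have hbre := (hb r).2
  have hbr' : b r = a r + 1 := by omega
  have hbs' : (b s : ℤ) = a s - 1 := by omega
  have hpi : piInt a b = ((a r : ℤ) * a s + a s - 1) * T (s.val + 1) := by
    unfold piInt
    rw [prod_eq_of_one_of_eq (fun i => (a i : ℤ)) (fun i => (e i : ℤ)) r s hs
        (fun i hi => by simp [hlow i hi]) (fun i hi => by simp [hhigh i hi]),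
      prod_eq_of_one_of_eq (fun i => (b i : ℤ)) (fun i => (e i : ℤ)) r s hs
        (fun i hi => by simp [hlow i hi]) (fun i hi => by simp [hhigh i hi]),
      prod_eq_of_one_of_eq (fun i => (min (a i) (b i) : ℤ)) (fun i => (e i : ℤ)) r s hs
        (fun i hi => by simp [hlow i hi]) (fun i hi => by simp [hhigh i hi])]
    have h₁ : min (a r : ℤ) (b r) = a r := min_eq_left (by omega)
    have h₂ : min (a s : ℤ) (b s) = a s - 1 := by rw [hbs']; exact min_eq_right (by omega)
    simp only [h₁, h₂]
    simp only [hbs', hbr', hTdef]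
    push_cast
    ring
  have hsuma := sum_eq_of_one_of_eq (fun i => (a i : ℤ)) (fun i => (e i : ℤ)) r s hs
    (fun i hi => by simp [hlow i hi]) (fun i hi => by simp [hhigh i hi])
  change ((∑ i, (a i : ℤ)) - A k - ((k : ℤ) - 2)) * T k - T (k + 1) ≤ piInt a b
  change ∑ i, (a i : ℤ) = r.val + a r + a s + A (s.val + 1) at hsuma
  rw [hpi, hsuma]
  have hP := hpos (s.val + 1)
  have hsr : (s.val : ℤ) = r.val + 1 := by exact_mod_cast hs
  have hx : (1 : ℤ) ≤ a r := by exact_mod_cast har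
  have hxy : (a r : ℤ) + 1 ≤ a s := by omega
  have hxe : (a r : ℤ) + 1 ≤ e r := by omega
  have hye : (a s : ℤ) ≤ e s := by exact_mod_cast has
  rcases Nat.lt_or_ge s.val k with hsk | hks
  · have h := tail_bound_of_ge (p := s.val + 1) (u := a r + a s)
      (B := ((a r : ℤ) * a s + a s - 1) * T (s.val + 1)) hT hA hE hpos (by linarith)
      (mul_le_mul_of_nonneg_right (by nlinarith) hP) hsk (by omega)
    push_cast at h
    rw [show (r.val : ℤ) + a r + a s + A (s.val + 1) - A k - (k - 2) =
      a r + a s + A (s.val + 1) - A k - (k - (s.val + 1)) by rw [hsr]; ring]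
    linarith [hpos (k + 1)]
  · have hanti : ∀ j, j ≤ s.val + 1 → T (s.val + 1) ≤ T j := by
      intro j hj
      induction hj using Nat.decreasingInduction with
      | self => exact le_rfl
      | of_succ j hj ih =>
        rw [hT j (by omega)]
        exact ih.trans (le_mul_of_one_le_left (hpos _) (hE j (by omega)))
    suffices h : ((r.val : ℤ) + a r + a s + A (s.val + 1) - A k - (k - 2)) * T k ≤
        ((a r : ℤ) * a s + a s) * T (s.val + 1) by
      linarith [hanti (k + 1) (by omega)]
    rcases hks.eq_or_lt with rfl | hks
    · rw [hTs, hAs, hsr, ← mul_assoc]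
      apply mul_le_mul_of_nonneg_right _ hP
      nlinarith [mul_nonneg (sub_nonneg.2 hye) (sub_nonneg.2 (hxy.trans hye))]
    · have hbase : ((a r : ℤ) + a s + 2 - e r - e s) * T r.val ≤
          ((a r : ℤ) * a s + a s) * T (s.val + 1) := by
        rw [hTr, ← mul_assoc, ← mul_assoc]
        apply mul_le_mul_of_nonneg_right _ hP
        rcases le_or_gt ((a r : ℤ) + a s + 2 - e r - e s) 0 with h | h
        · rw [mul_assoc]
          exact (mul_nonpos_of_nonpos_of_nonneg h (by positivity)).trans (by positivity)
        · have h₁ : (e r : ℤ) = a r + 1 := by linarith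
          have h₂ : (e s : ℤ) = a s := by linarith
          rw [h₁, h₂]
          apply le_of_eq
          ring
      have h := tail_bound_of_le (p := r.val) hT hA hE hpos (by linarith)
        (mul_nonneg (by positivity) hP) hbase (k := k) (by omega) r.isLt.le
      convert h using 2
      rw [hAr]
      ring
end

section
/- Let d ≥ 1 and 1 ≤ e_1 ≤ ⋯ ≤ e_m be integers. Suppose 1 ≤ a_i ≤ e_i and 1 ≤ b_i ≤ e_i, for i = 1,…,m, are integers such that d = Σ_{i=1}^m a_i = Σ_{i=1}^m b_i and (a_1,…,a_m) ≠ (b_1,…,b_m). Then for every k = 1,…,m−1: π(a,b) ≥ (Σ_{i=1}^m a_i − Σ_{i=k+1}^m e_i − (k−2))·e_{k+1}⋯e_m − e_{k+2}⋯e_m, where the empty product e_{k+2}⋯e_m equals 1 when k = m−1. -/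
open Finset

/-- Lower bound for a product of integers `≥ 1` with prescribed sum: the product is smallest when
the factors over `Q` are as large as their bounds `e` allow. -/
lemma sum_sub_mul_prod_le_prod {ι : Type*} [DecidableEq ι] (H Q : Finset ι) (hHQ : Disjoint H Q)
    (e a : ι → ℤ) (hH : ∀ h ∈ H, 1 ≤ a h) (hQ : ∀ q ∈ Q, 1 ≤ a q ∧ a q ≤ e q)
    (hle : ∀ h ∈ H, ∀ q ∈ Q, a h ≤ e q) :
    (∑ i ∈ H, a i + ∑ i ∈ Q, a i - ∑ i ∈ Q, e i - (#H : ℤ) + 1) * ∏ i ∈ Q, e i ≤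
      (∏ i ∈ H, a i) * ∏ i ∈ Q, a i := by
  induction hn : (∑ i ∈ H, a i).toNat using Nat.strong_induction_on generalizing a with
  | _ n ih =>
  have hP : 0 < ∏ i ∈ Q, e i := prod_pos fun q hq => by have := hQ q hq; omega
  have hA : 0 < ∏ i ∈ Q, a i := prod_pos fun q hq => by have := hQ q hq; omega
  have hsumH : (#H : ℤ) ≤ ∑ i ∈ H, a i := by simpa using card_nsmul_le_sum H a 1 hH
  by_cases hfull : ∀ q ∈ Q, a q = e q
  · rw [sum_congr rfl hfull, prod_congr rfl hfull]
    refine mul_le_mul_of_nonneg_right ?_ hP.le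
    have key : ∀ S ⊆ H, ∑ i ∈ S, a i - (#S : ℤ) + 1 ≤ ∏ i ∈ S, a i ∧ 1 ≤ ∏ i ∈ S, a i := by
      intro S
      induction S using Finset.induction_on with
      | empty => simp
      | insert x S hx ihS =>
        intro hS
        obtain ⟨h1, h2⟩ := ihS fun y hy => hS (mem_insert_of_mem hy)
        have hx1 := hH x (hS (mem_insert_self x S))
        rw [sum_insert hx, prod_insert hx, card_insert_of_notMem hx]
        push_cast
        constructor <;> nlinarith
    linarith [(key H subset_rfl).1]
  push Not at hfull
  obtain ⟨q, hq, hqe⟩ := hfull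
  have hqlt : a q + 1 ≤ e q := by have := hQ q hq; omega
  by_cases hone : ∀ h ∈ H, a h = 1
  · have hs : ∑ i ∈ H, a i = #H := by rw [sum_congr rfl hone]; simp
    have hlt : ∑ i ∈ Q, a i < ∑ i ∈ Q, e i :=
      sum_lt_sum (fun i hi => (hQ i hi).2) ⟨q, hq, by omega⟩
    rw [prod_congr rfl hone, hs]
    simp only [prod_const_one, one_mul]
    nlinarith
  push Not at hone
  obtain ⟨h, hh, hh1⟩ := hone
  have hh2 : 2 ≤ a h := by have := hH h hh; omega
  have hhq : h ≠ q := fun hc => disjoint_left.mp hHQ hh (hc ▸ hq)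
  have hqH : q ∉ H := fun hc => disjoint_left.mp hHQ hc hq
  have hhQ : h ∉ Q := fun hc => disjoint_left.mp hHQ hh hc
  have hq1 := (hQ q hq).1
  have hle' := hle h hh q hq
  -- transfer from `h` to `q` so that the product does not grow
  obtain ⟨x, y, hxy, hx1, hxh, hy1, hye, hprod⟩ : ∃ x y : ℤ, x + y = a h + a q ∧ 1 ≤ x ∧
      x < a h ∧ 1 ≤ y ∧ y ≤ e q ∧ x * y ≤ a h * a q := by
    rcases le_or_gt (a h) (a q) with hc | hc
    · exact ⟨a h - 1, a q + 1, by ring, by omega, by omega, by omega, hqlt, by nlinarith⟩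
    · exact ⟨a q, a h, by ring, hq1, hc, by omega, hle', by nlinarith⟩
  let c : ι → ℤ := fun i => if i = h then x else if i = q then y else a i
  have c_h : c h = x := by simp [c]
  have c_q : c q = y := by simp [c, hhq.symm]
  have c_H : ∀ i ∈ H.erase h, c i = a i := fun i hi => by
    have h1 := ne_of_mem_erase hi
    have h2 : i ≠ q := fun hc => hqH (hc ▸ mem_of_mem_erase hi)
    simp [c, h1, h2]
  have c_Q : ∀ i ∈ Q.erase q, c i = a i := fun i hi => by
    have h1 := ne_of_mem_erase hi
    have h2 : i ≠ h := fun hc => hhQ (hc ▸ mem_of_mem_erase hi)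
    simp [c, h1, h2]
  have sH : ∑ i ∈ H, c i = x + ∑ i ∈ H.erase h, a i := by
    rw [← add_sum_erase H c hh, c_h, sum_congr rfl c_H]
  have sQ : ∑ i ∈ Q, c i = y + ∑ i ∈ Q.erase q, a i := by
    rw [← add_sum_erase Q c hq, c_q, sum_congr rfl c_Q]
  have pH : ∏ i ∈ H, c i = x * ∏ i ∈ H.erase h, a i := by
    rw [← mul_prod_erase H c hh, c_h, prod_congr rfl c_H]
  have pQ : ∏ i ∈ Q, c i = y * ∏ i ∈ Q.erase q, a i := by
    rw [← mul_prod_erase Q c hq, c_q, prod_congr rfl c_Q]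
  have sH0 := add_sum_erase H a hh
  have sQ0 := add_sum_erase Q a hq
  have pH0 := mul_prod_erase H a hh
  have pQ0 := mul_prod_erase Q a hq
  have c_le : ∀ i ∈ H, 1 ≤ c i ∧ c i ≤ a i := fun i hi => by
    by_cases hc : i = h
    · subst hc; rw [c_h]; exact ⟨hx1, hxh.le⟩
    · rw [c_H i (mem_erase.mpr ⟨hc, hi⟩)]; exact ⟨hH i hi, le_rfl⟩
  have hcard : 0 < #H := card_pos.mpr ⟨h, hh⟩
  have hrec := ih (∑ i ∈ H, c i).toNat (by omega) c (fun i hi => (c_le i hi).1)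
    (fun i hi => by
      by_cases hc : i = q
      · subst hc; rw [c_q]; exact ⟨hy1, hye⟩
      · rw [c_Q i (mem_erase.mpr ⟨hc, hi⟩)]; exact hQ i hi)
    (fun i hi j hj => (c_le i hi).2.trans (hle i hi j hj)) rfl
  rw [sH, sQ, pH, pQ] at hrec
  rw [← sH0, ← sQ0, ← pH0, ← pQ0]
  have hR : 0 ≤ (∏ i ∈ H.erase h, a i) * ∏ i ∈ Q.erase q, a i :=
    mul_nonneg (prod_nonneg fun i hi => by linarith [hH i (mem_of_mem_erase hi)])
      (prod_nonneg fun i hi => by linarith [(hQ i (mem_of_mem_erase hi)).1])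
  have hmul := mul_le_mul_of_nonneg_right hprod hR
  have hsum : x + ∑ i ∈ H.erase h, a i + (y + ∑ i ∈ Q.erase q, a i) =
      a h + ∑ i ∈ H.erase h, a i + (a q + ∑ i ∈ Q.erase q, a i) := by linarith
  rw [hsum] at hrec
  linarith

/-- The union of the boxes with side lengths `a` and `b` contains the box `a` together with the
slab of the box `b` lying above `a` in direction `i`. -/
lemma prod_add_slab_le {ι : Type*} [DecidableEq ι] (S : Finset ι) (a b : ι → ℤ)
    (ha : ∀ i ∈ S, 0 ≤ a i) (hb : ∀ i ∈ S, 0 ≤ b i) {i : ι} (hi : i ∈ S) :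
    ∏ l ∈ S, a l + (b i - a i) * ∏ l ∈ S.erase i, b l ≤
      ∏ l ∈ S, a l + ∏ l ∈ S, b l - ∏ l ∈ S, min (a l) (b l) := by
  have hmin : ∏ l ∈ S, min (a l) (b l) ≤ a i * ∏ l ∈ S.erase i, b l := by
    rw [← mul_prod_erase S _ hi]
    have hnn : ∀ l ∈ S.erase i, 0 ≤ min (a l) (b l) := fun l hl =>
      le_min (ha l (mem_of_mem_erase hl)) (hb l (mem_of_mem_erase hl))
    exact mul_le_mul (min_le_left _ _) (prod_le_prod hnn fun l _ => min_le_right _ _)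
      (prod_nonneg hnn) (ha i hi)
  rw [← mul_prod_erase S b hi]
  linarith

lemma succ_mul_sub_one_le {s x y c : ℤ} (hs : 0 < s) (hsx : s ≤ x) (hxy : x < y) (hyc : y ≤ c) :
    (s + 1) * c - 1 ≤ x * (s - x + c) + (y - x) * (s - y + c) := by
  obtain ⟨u, rfl⟩ : ∃ u, x = s + u := ⟨x - s, by ring⟩
  obtain ⟨v, rfl⟩ : ∃ v, y = s + u + 1 + v := ⟨y - (s + u + 1), by ring⟩
  obtain ⟨w, rfl⟩ : ∃ w, c = s + u + 1 + v + w := ⟨c - (s + u + 1 + v), by ring⟩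
  have hu : 0 ≤ u := by linarith
  have hv : 0 ≤ v := by linarith
  have hw : 0 ≤ w := by linarith
  nlinarith [mul_nonneg hu hv, mul_nonneg hu hw, mul_nonneg hv hw,
    mul_nonneg hv (by linarith : 0 ≤ s - 1)]

/-- Lower bound for the size of the union of two distinct boxes with the same total side length,
where the coordinates are split into `H` (smaller bounds) and `Q` (larger bounds), and `p` has the
smallest bound in `Q`. -/
lemma union_boxes_lower_bound {ι : Type*} [DecidableEq ι] (H Q : Finset ι) (hHQ : Disjoint H Q)
    (e a b : ι → ℤ) (ha : ∀ i ∈ H ∪ Q, 1 ≤ a i ∧ a i ≤ e i)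
    (hb : ∀ i ∈ H ∪ Q, 1 ≤ b i ∧ b i ≤ e i) {p : ι} (hp : p ∈ Q)
    (hpQ : ∀ q ∈ Q, e p ≤ e q) (hpH : ∀ h ∈ H, e h ≤ e p)
    (hsum : ∑ i ∈ H ∪ Q, a i = ∑ i ∈ H ∪ Q, b i) {i : ι} (hi : i ∈ H ∪ Q) (hlt : a i < b i) :
    (∑ i ∈ H ∪ Q, a i - ∑ i ∈ Q, e i - ((#H : ℤ) - 2)) * ∏ i ∈ Q, e i -
        ∏ i ∈ Q.erase p, e i ≤
      ∏ i ∈ H ∪ Q, a i + ∏ i ∈ H ∪ Q, b i - ∏ i ∈ H ∪ Q, min (a i) (b i) := by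
  have hHe : ∀ h ∈ H, ∀ q ∈ Q, e h ≤ e q := fun h hh q hq => (hpH h hh).trans (hpQ q hq)
  have he : ∀ q ∈ Q, 1 ≤ e q := fun q hq => by
    have := ha q (mem_union_right _ hq); omega
  have bound : ∀ c : ι → ℤ, (∀ i ∈ H ∪ Q, 1 ≤ c i ∧ c i ≤ e i) →
      (∑ i ∈ H ∪ Q, c i - ∑ i ∈ Q, e i - (#H : ℤ) + 1) * ∏ i ∈ Q, e i ≤ ∏ i ∈ H ∪ Q, c i := by
    intro c hc
    rw [sum_union hHQ, prod_union hHQ]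
    exact sum_sub_mul_prod_le_prod H Q hHQ e c (fun h hh => (hc h (mem_union_left _ hh)).1)
      (fun q hq => hc q (mem_union_right _ hq))
      fun h hh q hq => (hc h (mem_union_left _ hh)).2.trans (hHe h hh q hq)
  refine le_trans ?_ (prod_add_slab_le (H ∪ Q) a b (fun i hi => by linarith [(ha i hi).1])
    (fun i hi => by linarith [(hb i hi).1]) hi)
  set s : ℤ := ∑ i ∈ H ∪ Q, a i - ∑ i ∈ Q, e i - (#H : ℤ) + 1 with hs
  have hs2 : ∑ i ∈ H ∪ Q, a i - ∑ i ∈ Q, e i - ((#H : ℤ) - 2) = s + 1 := by rw [hs]; ring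
  rw [hs2]
  have hPp := mul_prod_erase Q e hp
  have hSp := add_sum_erase Q e hp
  have hPpos : 0 < ∏ i ∈ Q.erase p, e i :=
    prod_pos fun q hq => by linarith [he q (mem_of_mem_erase hq)]
  have hep := he p hp
  have hai := ha i hi
  have hbi := hb i hi
  have hbpos : 0 < ∏ l ∈ (H ∪ Q).erase i, b l :=
    prod_pos fun l hl => by linarith [(hb l (mem_of_mem_erase hl)).1]
  have hA := bound a ha
  rw [← hs] at hA
  have hpnH : p ∉ H := fun hc => disjoint_left.mp hHQ hc hp
  rcases le_or_gt s 0 with hs0 | hs0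
  · have hdisj : Disjoint (insert p H) (Q.erase p) := by
      rw [disjoint_insert_left]
      exact ⟨notMem_erase p Q, hHQ.mono_right (erase_subset p Q)⟩
    have hun : insert p H ∪ Q.erase p = H ∪ Q := by
      rw [insert_union, ← union_insert, insert_erase hp]
    have h1 := sum_sub_mul_prod_le_prod (insert p H) (Q.erase p) hdisj e a
      (fun h hh => (ha h (hun ▸ mem_union_left _ hh)).1)
      (fun q hq => ha q (hun ▸ mem_union_right _ hq))
      (fun h hh q hq => (ha h (hun ▸ mem_union_left _ hh)).2.trans (by
        have := hpQ q (mem_of_mem_erase hq)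
        rcases mem_insert.mp hh with rfl | hh
        · exact this
        · exact (hpH h hh).trans this))
    rw [← sum_union hdisj, ← prod_union hdisj, hun, card_insert_of_notMem hpnH] at h1
    have h2 : ∑ i ∈ H ∪ Q, a i - ∑ i ∈ Q.erase p, e i - ((#H + 1 : ℕ) : ℤ) + 1 = s + e p - 1 := by
      push_cast; linarith
    rw [h2] at h1
    rw [← hPp]
    have h3 : 0 ≤ (b i - a i) * ∏ l ∈ (H ∪ Q).erase i, b l :=
      mul_nonneg (by linarith) hbpos.le
    have h4 : (s + 1) * e p - 1 ≤ s + e p - 1 := by nlinarith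
    have h5 := mul_le_mul_of_nonneg_right h4 hPpos.le
    linarith
  rcases lt_or_ge (a i) s with has | has
  · have h1 := bound (Function.update b i (b i - a i)) (fun l hl => by
      by_cases hc : l = i
      · subst hc; rw [Function.update_self]; constructor <;> linarith
      · rw [Function.update_of_ne hc]; exact hb l hl)
    have hcongr : ∀ l ∈ (H ∪ Q).erase i, Function.update b i (b i - a i) l = b l :=
      fun l hl => Function.update_of_ne (ne_of_mem_erase hl) _ _
    rw [← add_sum_erase _ _ hi, ← mul_prod_erase _ _ hi, sum_congr rfl hcongr,
      prod_congr rfl hcongr, Function.update_self] at h1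
    have h2 := add_sum_erase _ b hi
    have h3 : b i - a i + ∑ l ∈ (H ∪ Q).erase i, b l - ∑ i ∈ Q, e i - (#H : ℤ) + 1 = s - a i := by
      linarith
    rw [h3] at h1
    have hP : 0 < ∏ i ∈ Q, e i := by rw [← hPp]; positivity
    nlinarith
  rcases mem_union.mp hi with hiH | hiQ
  · -- `i ∈ H`: the remaining coordinates of `b` are bounded with `p` moved to the first part
    have hpE : p ∉ H.erase i := fun hc => hpnH (mem_of_mem_erase hc)
    have hiQ : i ∉ Q := fun hc => disjoint_left.mp hHQ hiH hc
    have hdisj : Disjoint (insert p (H.erase i)) (Q.erase p) := by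
      rw [disjoint_insert_left]
      exact ⟨notMem_erase p Q, hHQ.mono (erase_subset i H) (erase_subset p Q)⟩
    have hun : insert p (H.erase i) ∪ Q.erase p = (H ∪ Q).erase i := by
      rw [insert_union, ← union_insert, insert_erase hp, erase_union_distrib,
        erase_eq_of_notMem hiQ]
    have hcard : (#(insert p (H.erase i)) : ℤ) = #H := by
      rw [card_insert_of_notMem hpE, card_erase_add_one hiH]
    have rest : ∀ c : ι → ℤ, (∀ i ∈ H ∪ Q, 1 ≤ c i ∧ c i ≤ e i) →
        ∑ i ∈ H ∪ Q, c i = ∑ i ∈ H ∪ Q, a i →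
        (s - c i + e p) * ∏ i ∈ Q.erase p, e i ≤ ∏ l ∈ (H ∪ Q).erase i, c l := by
      intro c hc hsc
      have hc' : ∀ l ∈ insert p (H.erase i) ∪ Q.erase p, 1 ≤ c l ∧ c l ≤ e l := fun l hl => by
        rw [hun] at hl; exact hc l (mem_of_mem_erase hl)
      have h1 := sum_sub_mul_prod_le_prod (insert p (H.erase i)) (Q.erase p) hdisj e c
        (fun h hh => (hc' h (mem_union_left _ hh)).1)
        (fun q hq => hc' q (mem_union_right _ hq))
        (fun h hh q hq => (hc' h (mem_union_left _ hh)).2.trans (by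
          have := hpQ q (mem_of_mem_erase hq)
          rcases mem_insert.mp hh with rfl | hh
          · exact this
          · exact (hpH h (mem_of_mem_erase hh)).trans this))
      rw [← sum_union hdisj, ← prod_union hdisj, hun, hcard] at h1
      have h2 := add_sum_erase _ c hi
      convert h1 using 2
      linarith
    have hra := rest a ha rfl
    have hrb := rest b hb hsum.symm
    have hie := hpH i hiH
    rw [← mul_prod_erase _ a hi, ← hPp]
    have k1 := mul_le_mul_of_nonneg_left hra (by linarith : 0 ≤ a i)
    have k2 := mul_le_mul_of_nonneg_left hrb (by linarith : 0 ≤ b i - a i)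
    have k3 := succ_mul_sub_one_le hs0 has hlt (hbi.2.trans hie)
    have k4 := mul_le_mul_of_nonneg_right k3 hPpos.le
    linarith
  · have hiH : i ∉ H := fun hc => disjoint_left.mp hHQ hc hiQ
    have hdisj : Disjoint H (Q.erase i) := hHQ.mono_right (erase_subset i Q)
    have hun : H ∪ Q.erase i = (H ∪ Q).erase i := by
      rw [erase_union_distrib, erase_eq_of_notMem hiH]
    have hPi := mul_prod_erase Q e hiQ
    have hSi := add_sum_erase Q e hiQ
    have rest : ∀ c : ι → ℤ, (∀ i ∈ H ∪ Q, 1 ≤ c i ∧ c i ≤ e i) →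
        ∑ i ∈ H ∪ Q, c i = ∑ i ∈ H ∪ Q, a i →
        (s - c i + e i) * ∏ l ∈ Q.erase i, e l ≤ ∏ l ∈ (H ∪ Q).erase i, c l := by
      intro c hc hsc
      have h1 := sum_sub_mul_prod_le_prod H (Q.erase i) hdisj e c
        (fun h hh => (hc h (mem_union_left _ hh)).1)
        (fun q hq => hc q (mem_union_right _ (mem_of_mem_erase hq)))
        (fun h hh q hq => (hc h (mem_union_left _ hh)).2.trans
          (hHe h hh q (mem_of_mem_erase hq)))
      rw [← sum_union hdisj, ← prod_union hdisj, hun] at h1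
      have h2 := add_sum_erase _ c hi
      convert h1 using 2
      linarith
    have hra := rest a ha rfl
    have hrb := rest b hb hsum.symm
    have hRpos : 0 < ∏ l ∈ Q.erase i, e l :=
      prod_pos fun q hq => by linarith [he q (mem_of_mem_erase hq)]
    have hRle : ∏ l ∈ Q.erase i, e l ≤ ∏ l ∈ Q.erase p, e l := by
      have := hpQ i hiQ
      by_contra! hc
      nlinarith
    rw [← mul_prod_erase _ a hi, ← hPi]
    have k1 := mul_le_mul_of_nonneg_left hra (by linarith : 0 ≤ a i)
    have k2 := mul_le_mul_of_nonneg_left hrb (by linarith : 0 ≤ b i - a i)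
    have k3 := succ_mul_sub_one_le hs0 has hlt hbi.2
    have k4 := mul_le_mul_of_nonneg_right k3 hRpos.le
    linarith

/-- Let `d ≥ 1` and `1 ≤ e_1 ≤ ⋯ ≤ e_m` be integers.  Suppose
`1 ≤ a_i ≤ e_i` and `1 ≤ b_i ≤ e_i` are integers such that `d = Σ a_i = Σ b_i` and `a ≠ b`.
Then for every `k = 1, …, m−1`,
`π(a,b) ≥ (Σ_i a_i − Σ_{i>k} e_i − (k−2)) · e_{k+1} ⋯ e_m − e_{k+2} ⋯ e_m`
(`1`-based products; the empty product `e_{k+2} ⋯ e_m` is `1` when `k = m−1`). -/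
theorem stmt_14 {m : ℕ} (d : ℕ) (hd : 1 ≤ d) (e a b : Fin m → ℕ)
    (he1 : ∀ i, 1 ≤ e i) (hemono : ∀ i j : Fin m, i ≤ j → e i ≤ e j)
    (ha : ∀ i, 1 ≤ a i ∧ a i ≤ e i) (hb : ∀ i, 1 ≤ b i ∧ b i ≤ e i)
    (hda : ∑ i, a i = d) (hdb : ∑ i, b i = d) (hne : a ≠ b) :
    ∀ k : ℕ, 1 ≤ k → k ≤ m - 1 →
      ((∑ i, (a i : ℤ)) - (∑ i ∈ univ.filter (fun i : Fin m => k ≤ i.val), (e i : ℤ)) -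
            ((k : ℤ) - 2)) *
          (∏ i ∈ univ.filter (fun i : Fin m => k ≤ i.val), (e i : ℤ)) -
        (∏ i ∈ univ.filter (fun i : Fin m => k + 1 ≤ i.val), (e i : ℤ)) ≤
      piInt a b := by
  intro k hk1 hkm
  have hkm' : k < m := by omega
  have hun : univ.filter (fun i : Fin m => i.val < k) ∪ univ.filter (fun i : Fin m => k ≤ i.val) =
      univ := by
    ext i; simp; omega
  have hdisj : Disjoint (univ.filter (fun i : Fin m => i.val < k))
      (univ.filter (fun i : Fin m => k ≤ i.val)) := by
    rw [disjoint_left]; intro i; simp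
  have hcard : #(univ.filter (fun i : Fin m => i.val < k)) = k := by
    rw [Fin.card_filter_val_lt, min_eq_right hkm'.le]
  have herase : univ.filter (fun i : Fin m => k + 1 ≤ i.val) =
      (univ.filter (fun i : Fin m => k ≤ i.val)).erase ⟨k, hkm'⟩ := by
    ext i; simp [Fin.ext_iff]; omega
  obtain ⟨i, -, hi⟩ : ∃ i ∈ univ, a i < b i := by
    by_contra! hc
    refine hne (funext fun i => ?_)
    exact ((sum_eq_sum_iff_of_le hc).mp (hdb.trans hda.symm) i (mem_univ i)).symm
  have key := union_boxes_lower_bound _ _ hdisj (fun i => (e i : ℤ)) (fun i => (a i : ℤ))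
    (fun i => (b i : ℤ)) (fun i _ => by exact_mod_cast ha i) (fun i _ => by exact_mod_cast hb i)
    (p := ⟨k, hkm'⟩) (by simp)
    (fun q hq => by
      have hq' : k ≤ q.val := by simpa using hq
      exact_mod_cast hemono _ _ hq')
    (fun h hh => by
      have hh' : h.val < k := by simpa using hh
      exact_mod_cast hemono _ _ hh'.le)
    (by rw [hun]; exact_mod_cast hda.trans hdb.symm) (i := i) (by rw [hun]; exact mem_univ i)
    (by exact_mod_cast hi)
  rw [hun, hcard, ← herase] at key
  exact key
end

section
/- Let n ≥ 2 and let 1 ≤ d_1 ≤ ⋯ ≤ d_n be integers. Let α = (α_1,…,α_n) and β = (β_1,…,β_n) be integer sequences with 0 ≤ α_i ≤ d_i − 1 and 0 ≤ β_i ≤ d_i − 1 for all i, such that Σ_{i=1}^n α_i = Σ_{i=1}^n β_i and α ≠ β. Then for every k = 0,…,n−2: P(α,β) ≥ (Σ_{i=1}^{k+1}(d_i − α_i) − (k−1) − Σ_{i=k+2}^n α_i)·d_{k+2}⋯d_n − d_{k+3}⋯d_n, where the empty product d_{k+3}⋯d_n equals 1 when k = n−2. -/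
open Finset

/-- A box `∏ [1, a i]` inside `∏ [1, d i]`, with `d` monotone, of total codimension
`∑ (d i - a i)`, has at least as many points as the box filled greedily. -/
lemma greedy_le_prod (n : ℕ) : ∀ (d a : ℕ → ℤ), (∀ i < n, 1 ≤ a i) → (∀ i < n, a i ≤ d i) →
    (∀ i j, i ≤ j → j < n → d i ≤ d j) → ∀ m ≤ n,
    (1 + ∑ i ∈ range m, (d i - 1) - ∑ i ∈ range n, (d i - a i)) * ∏ i ∈ Ico m n, d i ≤
      ∏ i ∈ range n, a i := by
  induction n with
  | zero =>
    intro d a _ _ _ m hm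
    obtain rfl : m = 0 := by omega
    simp
  | succ n ih =>
    intro d a ha had hd m hm
    have hdpos : ∀ i < n + 1, 1 ≤ d i := fun i hi => (ha i hi).trans (had i hi)
    have hD : ∀ k, 0 ≤ ∏ i ∈ Ico k (n + 1), d i := fun k =>
      prod_nonneg fun i hi => by have := hdpos i (mem_Ico.1 hi).2; omega
    rcases m with _ | m
    · have hA : 0 ≤ ∏ i ∈ range (n + 1), a i :=
        prod_nonneg fun i hi => by have := ha i (mem_range.1 hi); omega
      have hS : ∀ i ∈ range (n + 1), 0 ≤ d i - a i := fun i hi => by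
        have := had i (mem_range.1 hi); omega
      rcases (sum_nonneg hS).eq_or_lt with h0 | h0
      · have hda := (sum_eq_zero_iff_of_nonneg hS).1 h0.symm
        rw [← h0, ← range_eq_Ico, prod_congr rfl fun i hi => sub_eq_zero.1 (hda i hi)]
        simp
      · have := hD 0
        simp only [range_zero, sum_empty]
        nlinarith
    · have key := ih (fun i => d (i + 1)) (fun i => a (i + 1)) (fun i hi => ha _ (by omega))
        (fun i hi => had _ (by omega)) (fun i j hij hj => hd _ _ (by omega) (by omega))
      simp only [prod_Ico_add' d _ n 1] at key
      have ha0 := ha 0 (by omega)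
      rw [sum_range_succ' _ m, sum_range_succ' _ n, prod_range_succ']
      set T := ∑ i ∈ range m, (d (i + 1) - 1) with hT
      set S := ∑ i ∈ range n, (d (i + 1) - a (i + 1)) with hS
      set A := ∏ i ∈ range n, a (i + 1) with hA
      have k1 := key m (by omega)
      rw [← hT] at k1
      by_cases hX : a 0 ≤ T - S + a 0
      · have h1 := mul_le_mul_of_nonneg_right k1 (show 0 ≤ a 0 by omega)
        have h2 : 0 ≤ (a 0 - 1) * (T - S) * ∏ i ∈ Ico (m + 1) (n + 1), d i :=
          mul_nonneg (mul_nonneg (by omega) (by omega)) (hD _)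
        nlinarith
      · have hmn : m < n := by
          by_contra hcon
          obtain rfl : m = n := by omega
          have : 0 ≤ T - S := by
            rw [hT, hS, ← sum_sub_distrib]
            exact sum_nonneg fun i hi => by
              have := ha (i + 1) (by have := mem_range.1 hi; omega)
              omega
          omega
        have k2 := key (m + 1) (by omega)
        rw [sum_range_succ, ← hT] at k2
        rw [prod_eq_prod_Ico_succ_bot (show m + 1 < n + 1 by omega)]
        have h1 := mul_le_mul_of_nonneg_right k2 (show 0 ≤ a 0 by omega)
        have h2 : 0 ≤ (S - T) * (d (m + 1) - a 0) * ∏ i ∈ Ico (m + 1 + 1) (n + 1), d i :=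
          mul_nonneg (mul_nonneg (by omega)
            (by have := had 0 (by omega); have := hd 0 (m + 1) (by omega) (by omega); omega))
            (hD _)
        nlinarith

/-- The three-case estimate behind the union bound when the first coordinates `a < b` differ;
`u` and `v` are the cardinalities of the slices of the two boxes. -/
lemma union_step {a b d X D u v : ℤ} (ha : 1 ≤ a) (hab : a < b) (hbd : b ≤ d) (hD : 0 ≤ D)
    (hu : (X - a) * (d * D) ≤ u) (hu' : (X - a + d - 1) * D ≤ u)
    (hv : (X - b) * (d * D) ≤ v) (hv' : (X - b + d - 1) * D ≤ v) :
    X * (d * D) - D ≤ a * u + (b - a) * v := by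
  rcases le_or_gt (b + 1) X with h | h
  · have e : 0 ≤ (a * (X - a) + (b - a) * (X - b) - X) * d + 1 := by
      have : 0 ≤ a * (X - a) + (b - a) * (X - b) - X := by
        nlinarith [mul_nonneg (show 0 ≤ b - 1 by omega) (show 0 ≤ X - (b + 1) by omega),
          mul_nonneg (show 0 ≤ a - 1 by omega) (show 0 ≤ b - a - 1 by omega)]
      have := mul_nonneg this (show 0 ≤ d by omega)
      omega
    nlinarith [mul_nonneg e hD, mul_le_mul_of_nonneg_left hu (show 0 ≤ a by omega),
      mul_le_mul_of_nonneg_left hv (show 0 ≤ b - a by omega)]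
  rcases le_or_gt (a + 1) X with h' | h'
  · have e : 0 ≤ a * (X - a) * d + (b - a) * (X - b + d - 1) - X * d + 1 := by
      obtain ⟨s, rfl⟩ : ∃ s, X = a + 1 + s := ⟨X - (a + 1), by ring⟩
      obtain ⟨t, rfl⟩ : ∃ t, b = a + 1 + s + t := ⟨b - (a + 1 + s), by ring⟩
      obtain ⟨w, rfl⟩ : ∃ w, d = a + 1 + s + t + w := ⟨d - (a + 1 + s + t), by ring⟩
      obtain ⟨c, rfl⟩ : ∃ c, a = c + 1 := ⟨a - 1, by ring⟩
      have hs : 0 ≤ s := by omega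
      have ht : 0 ≤ t := by omega
      have hw : 0 ≤ w := by omega
      have hc : 0 ≤ c := by omega
      ring_nf
      positivity
    nlinarith [mul_nonneg e hD, mul_le_mul_of_nonneg_left hu (show 0 ≤ a by omega),
      mul_le_mul_of_nonneg_left hv' (show 0 ≤ b - a by omega)]
  · have e : 0 ≤ a * (X - a + d - 1) + (b - a) * (X - b + d - 1) - X * d + 1 := by
      nlinarith [mul_nonneg (show 0 ≤ b - X by omega) (show 0 ≤ d - b by omega),
        mul_nonneg (show 0 ≤ a - 1 by omega) (show 0 ≤ b - a - 1 by omega)]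
    nlinarith [mul_nonneg e hD, mul_le_mul_of_nonneg_left hu' (show 0 ≤ a by omega),
      mul_le_mul_of_nonneg_left hv' (show 0 ≤ b - a by omega)]

/-- Two distinct boxes of equal codimension: their union has at least as many points as the union
of the two greediest ones.  The correction term is absent for `m = n`. -/
lemma greedy_le_union (n : ℕ) : ∀ (d a b : ℕ → ℤ), (∀ i < n, 1 ≤ a i) → (∀ i < n, a i ≤ d i) →
    (∀ i < n, 1 ≤ b i) → (∀ i < n, b i ≤ d i) → (∀ i j, i ≤ j → j < n → d i ≤ d j) →
    ∑ i ∈ range n, a i = ∑ i ∈ range n, b i → (∃ i < n, a i ≠ b i) → ∀ m ≤ n,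
    (2 + ∑ i ∈ range m, (d i - 1) - ∑ i ∈ range n, (d i - a i)) * ∏ i ∈ Ico m n, d i -
        (if m < n then ∏ i ∈ Ico (m + 1) n, d i else 0) ≤
      ∏ i ∈ range n, a i + ∏ i ∈ range n, b i - ∏ i ∈ range n, min (a i) (b i) := by
  induction n with
  | zero =>
    rintro d a b _ _ _ _ _ _ ⟨i, hi, _⟩
    omega
  | succ n ih =>
    intro d a b ha had hb hbd hd hab hne m hm
    wlog hle : a 0 ≤ b 0 generalizing a b
    · have := this b a hb hbd ha had hab.symm (by simpa only [ne_comm] using hne) (by omega)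
      rw [sum_sub_distrib d b, ← hab, ← sum_sub_distrib] at this
      simpa only [min_comm (b _), add_comm (∏ i ∈ range (n + 1), b i)] using this
    have hdpos : ∀ i < n + 1, 1 ≤ d i := fun i hi => (ha i hi).trans (had i hi)
    have hD : ∀ k, 0 ≤ ∏ i ∈ Ico k (n + 1), d i := fun k =>
      prod_nonneg fun i hi => by have := hdpos i (mem_Ico.1 hi).2; omega
    have hMb : ∏ i ∈ range (n + 1), min (a i) (b i) ≤ ∏ i ∈ range (n + 1), b i :=
      prod_le_prod (fun i hi => by
        have := ha i (mem_range.1 hi); have := hb i (mem_range.1 hi); omega)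
        (fun i _ => min_le_right _ _)
    rcases m with _ | m
    · have hS : ∀ i ∈ range (n + 1), 0 ≤ d i - a i := fun i hi => by
        have := had i (mem_range.1 hi); omega
      have hS' : ∀ i ∈ range (n + 1), 0 ≤ d i - b i := fun i hi => by
        have := hbd i (mem_range.1 hi); omega
      have h1 := greedy_le_prod (n + 1) d a ha had hd 1 (by omega)
      rw [sum_range_one] at h1
      rw [if_pos (by omega), prod_eq_prod_Ico_succ_bot (show 0 < n + 1 by omega), sum_range_zero]
      have hD1 := hD 1
      have hd0 := hdpos 0 (by omega)
      have hA : 0 ≤ ∏ i ∈ range (n + 1), a i :=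
        prod_nonneg fun i hi => by have := ha i (mem_range.1 hi); omega
      rcases (sum_nonneg hS).eq_or_lt with h0 | h0
      · have hda := (sum_eq_zero_iff_of_nonneg hS).1 h0.symm
        rw [sum_sub_distrib, hab, ← sum_sub_distrib] at h0
        have hdb := (sum_eq_zero_iff_of_nonneg hS').1 h0.symm
        obtain ⟨i, hi, hi'⟩ := hne
        have := hda i (mem_range.2 hi)
        have := hdb i (mem_range.2 hi)
        omega
      · set S := ∑ i ∈ range (n + 1), (d i - a i)
        rcases (show 1 ≤ S by omega).eq_or_lt with h2 | h2
        · rw [← h2] at h1 ⊢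
          simp only [zero_add] at h1 ⊢
          nlinarith
        · have h3 : 0 ≤ (S - 2) * (d 0 * ∏ i ∈ Ico 1 (n + 1), d i) :=
            mul_nonneg (by omega) (mul_nonneg (by omega) hD1)
          simp only [zero_add] at h1 ⊢
          nlinarith
    · have ha0 := ha 0 (by omega)
      have hsum : ∑ i ∈ range n, a (i + 1) + a 0 = ∑ i ∈ range n, b (i + 1) + b 0 := by
        rw [← sum_range_succ', ← sum_range_succ', hab]
      have keyA := greedy_le_prod n (fun i => d (i + 1)) (fun i => a (i + 1))
        (fun i hi => ha _ (by omega)) (fun i hi => had _ (by omega))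
        (fun i j hij hj => hd _ _ (by omega) (by omega))
      have keyB := greedy_le_prod n (fun i => d (i + 1)) (fun i => b (i + 1))
        (fun i hi => hb _ (by omega)) (fun i hi => hbd _ (by omega))
        (fun i j hij hj => hd _ _ (by omega) (by omega))
      have hdm : m < n → b 0 ≤ d (m + 1) := fun h =>
        (hbd 0 (by omega)).trans (hd 0 (m + 1) (by omega) (by omega))
      have hTa : m = n → 0 ≤ ∑ i ∈ range m, (d (i + 1) - 1) -
          ∑ i ∈ range n, (d (i + 1) - a (i + 1)) := by
        rintro rfl
        rw [← sum_sub_distrib]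
        exact sum_nonneg fun i hi => by
          have := ha (i + 1) (by have := mem_range.1 hi; omega)
          omega
      have hTb : m = n → 0 ≤ ∑ i ∈ range m, (d (i + 1) - 1) -
          ∑ i ∈ range n, (d (i + 1) - b (i + 1)) := by
        rintro rfl
        rw [← sum_sub_distrib]
        exact sum_nonneg fun i hi => by
          have := hb (i + 1) (by have := mem_range.1 hi; omega)
          omega
      have hSab : ∑ i ∈ range n, (d (i + 1) - b (i + 1)) =
          ∑ i ∈ range n, (d (i + 1) - a (i + 1)) + (b 0 - a 0) := by
        rw [sum_sub_distrib, sum_sub_distrib]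
        linarith
      simp only [prod_Ico_add' d _ n 1] at keyA keyB
      have hMb' : ∏ i ∈ range n, min (a (i + 1)) (b (i + 1)) ≤ ∏ i ∈ range n, b (i + 1) :=
        prod_le_prod (fun i hi => by
          have := mem_range.1 hi
          have := ha (i + 1) (by omega); have := hb (i + 1) (by omega); omega)
          (fun i _ => min_le_right _ _)
      rw [sum_range_succ' _ m, sum_range_succ' _ n, prod_range_succ' _ n, prod_range_succ' _ n,
        prod_range_succ' _ n, min_eq_left hle]
      rw [hSab] at keyB hTb
      rcases hle.eq_or_lt with heq | hlt
      · have key := ih (fun i => d (i + 1)) (fun i => a (i + 1)) (fun i => b (i + 1))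
          (fun i hi => ha _ (by omega)) (fun i hi => had _ (by omega))
          (fun i hi => hb _ (by omega)) (fun i hi => hbd _ (by omega))
          (fun i j hij hj => hd _ _ (by omega) (by omega)) (by linarith)
          (by
            obtain ⟨i, hi, hi'⟩ := hne
            rcases i with _ | i
            · exact absurd heq hi'
            · exact ⟨i, by omega, hi'⟩)
        simp only [prod_Ico_add' d _ n 1] at key
        rw [← heq, ← add_mul, ← sub_mul]
        have k1 := key m (by omega)
        have k2 := key (m + 1)
        rw [sum_range_succ] at k2
        generalize ∑ i ∈ range m, (d (i + 1) - 1) = T at *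
        generalize ∑ i ∈ range n, (d (i + 1) - a (i + 1)) = S at *
        generalize ∏ i ∈ range n, a (i + 1) + ∏ i ∈ range n, b (i + 1) -
          ∏ i ∈ range n, min (a (i + 1)) (b (i + 1)) = P at *
        have hDm := hD (m + 1)
        rcases (show m ≤ n by omega).eq_or_lt with hmn | hmn
        · have hT := hTa hmn
          rw [if_neg (by omega)] at k1 ⊢
          generalize ∏ i ∈ Ico (m + 1) (n + 1), d i = D at *
          have h1 := mul_le_mul_of_nonneg_right k1 (show 0 ≤ a 0 by omega)
          have h2 : 0 ≤ (a 0 - 1) * (T - S + 1) * D :=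
            mul_nonneg (mul_nonneg (by omega) (by omega)) hDm
          nlinarith
        · have k2 := k2 (by omega)
          rw [if_pos hmn] at k1
          rw [if_pos (by omega)]
          have hD2 := hD (m + 1 + 1)
          have hdm := hdm hmn
          have hdm1 := hdpos (m + 1) (by omega)
          rw [prod_eq_prod_Ico_succ_bot (show m + 1 < n + 1 by omega)] at k1 ⊢
          have hlast : a 0 * (if m + 1 < n then ∏ i ∈ Ico (m + 1 + 1 + 1) (n + 1), d i else 0) ≤
              ∏ i ∈ Ico (m + 1 + 1) (n + 1), d i := by
            split_ifs with h
            · rw [prod_eq_prod_Ico_succ_bot (show m + 1 + 1 < n + 1 by omega)]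
              refine mul_le_mul_of_nonneg_right ?_ (hD _)
              exact (had 0 (by omega)).trans (hd _ _ (by omega) (by omega))
            · simpa using hD2
          generalize (if m + 1 < n then ∏ i ∈ Ico (m + 1 + 1 + 1) (n + 1), d i else 0) = L at *
          generalize ∏ i ∈ Ico (m + 1 + 1) (n + 1), d i = D at *
          by_cases hX : 0 ≤ T - S
          · have h1 := mul_le_mul_of_nonneg_right k1 (show 0 ≤ a 0 by omega)
            have h2 : 0 ≤ (a 0 - 1) * ((T - S + 1) * d (m + 1) - 1) * D :=
              mul_nonneg (mul_nonneg (by omega) (by nlinarith)) hD2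
            nlinarith
          · have h1 := mul_le_mul_of_nonneg_right k2 (show 0 ≤ a 0 by omega)
            have h2 : 0 ≤ (S - T - 1) * (d (m + 1) - a 0) * D :=
              mul_nonneg (mul_nonneg (by omega) (by omega)) hD2
            nlinarith
      · have kA := keyA m (by omega)
        have kB := keyB m (by omega)
        have kA' := keyA (m + 1)
        have kB' := keyB (m + 1)
        rw [sum_range_succ] at kA' kB'
        generalize ∑ i ∈ range m, (d (i + 1) - 1) = T at *
        generalize ∑ i ∈ range n, (d (i + 1) - a (i + 1)) = S at *
        generalize ∏ i ∈ range n, a (i + 1) = A at *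
        generalize ∏ i ∈ range n, b (i + 1) = B at *
        generalize ∏ i ∈ range n, min (a (i + 1)) (b (i + 1)) = M at *
        have hM := mul_le_mul_of_nonneg_right hMb' (show 0 ≤ a 0 by omega)
        rcases (show m ≤ n by omega).eq_or_lt with hmn | hmn
        · have hT := hTb hmn
          rw [if_neg (by omega)]
          obtain rfl := hmn
          simp only [Ico_self, prod_empty, mul_one] at kA kB ⊢
          nlinarith [mul_le_mul_of_nonneg_right kA (show 0 ≤ a 0 by omega),
            mul_le_mul_of_nonneg_right kB (show 0 ≤ b 0 - a 0 by omega),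
            mul_nonneg (show 0 ≤ b 0 - 1 by omega) hT,
            mul_nonneg (show 0 ≤ a 0 - 1 by omega) (show 0 ≤ b 0 - a 0 - 1 by omega)]
        · have kA' := kA' (by omega)
          have kB' := kB' (by omega)
          rw [if_pos (by omega)]
          rw [prod_eq_prod_Ico_succ_bot (show m + 1 < n + 1 by omega)] at kA kB ⊢
          have := union_step (X := T - S + a 0 + 1) ha0 hlt (hdm hmn) (hD (m + 1 + 1))
            (u := A) (v := B) (by linarith) (by linarith) (by linarith) (by linarith)
          linarith

/-- Let `n ≥ 2` and `1 ≤ d_1 ≤ ⋯ ≤ d_n`.  Let `α, β` be integer sequences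
with `0 ≤ α_i, β_i ≤ d_i − 1`, `Σ α_i = Σ β_i` and `α ≠ β`.  Then for every `k = 0, …, n−2`,
`P(α,β) ≥ (Σ_{i=1}^{k+1} (d_i − α_i) − (k−1) − Σ_{i=k+2}^n α_i) · d_{k+2} ⋯ d_n − d_{k+3} ⋯ d_n`,
where `P(α,β) = ∏ (d_i − α_i) + ∏ (d_i − β_i) − ∏ min(d_i − α_i, d_i − β_i)` and the empty
product `d_{k+3} ⋯ d_n` equals `1` when `k = n−2`.  (Indices are `0`-based below:
paper index `i` corresponds to `i.val + 1`.) -/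
theorem stmt_15 {n : ℕ} (hn : 2 ≤ n) (d α β : Fin n → ℕ)
    (hd1 : ∀ i, 1 ≤ d i) (hdmono : ∀ i j : Fin n, i ≤ j → d i ≤ d j)
    (hα : ∀ i, α i ≤ d i - 1) (hβ : ∀ i, β i ≤ d i - 1)
    (hsum : ∑ i, α i = ∑ i, β i) (hne : α ≠ β) :
    ∀ k : ℕ, k ≤ n - 2 →
      ((∑ i ∈ univ.filter (fun i : Fin n => i.val ≤ k), ((d i : ℤ) - (α i : ℤ))) -
            ((k : ℤ) - 1) -
            (∑ i ∈ univ.filter (fun i : Fin n => k + 1 ≤ i.val), (α i : ℤ))) *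
          (∏ i ∈ univ.filter (fun i : Fin n => k + 1 ≤ i.val), (d i : ℤ)) -
        (∏ i ∈ univ.filter (fun i : Fin n => k + 2 ≤ i.val), (d i : ℤ)) ≤
      (∏ i, ((d i : ℤ) - (α i : ℤ))) + (∏ i, ((d i : ℤ) - (β i : ℤ))) -
        ∏ i, min ((d i : ℤ) - (α i : ℤ)) ((d i : ℤ) - (β i : ℤ)) := by
  intro k hk
  have hext : ∀ f : Fin n → ℕ, ∃ g : ℕ → ℤ, ∀ i : Fin n, g i = f i := fun f =>
    ⟨fun i => if h : i < n then f ⟨i, h⟩ else 0, fun i => by simp⟩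
  obtain ⟨d', hd'⟩ := hext d
  obtain ⟨α', hα'⟩ := hext α
  obtain ⟨β', hβ'⟩ := hext β
  have hlow : ∀ g : ℕ → ℤ, ∑ i ∈ univ.filter (fun i : Fin n => i.val ≤ k), g i =
      ∑ i ∈ range (k + 1), g i := fun g => by
    rw [sum_filter, Fin.sum_univ_eq_sum_range (fun i => if i ≤ k then g i else 0), ← sum_filter]
    exact sum_congr (by ext i; simp only [mem_filter, mem_range]; omega) fun _ _ => rfl
  have hhigh : ∀ g : ℕ → ℤ, ∑ i ∈ univ.filter (fun i : Fin n => k + 1 ≤ i.val), g i =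
      ∑ i ∈ Ico (k + 1) n, g i := fun g => by
    rw [sum_filter, Fin.sum_univ_eq_sum_range (fun i => if k + 1 ≤ i then g i else 0),
      ← sum_filter]
    exact sum_congr (by ext i; simp only [mem_filter, mem_range, mem_Ico]; omega) fun _ _ => rfl
  have hprod : ∀ (m : ℕ) (g : ℕ → ℤ), ∏ i ∈ univ.filter (fun i : Fin n => m ≤ i.val), g i =
      ∏ i ∈ Ico m n, g i := fun m g => by
    rw [prod_filter, Fin.prod_univ_eq_prod_range (fun i => if m ≤ i then g i else 1),
      ← prod_filter]
    exact prod_congr (by ext i; simp only [mem_filter, mem_range, mem_Ico]; omega) fun _ _ => rfl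
  have hbound : ∀ (γ : Fin n → ℕ) (γ' : ℕ → ℤ), (∀ i, γ i ≤ d i - 1) → (∀ i : Fin n, γ' i = γ i) →
      ∀ i < n, 1 ≤ d' i - γ' i ∧ d' i - γ' i ≤ d' i := fun γ γ' hγ hγ' i hi => by
    have h1 := hγ ⟨i, hi⟩
    have h2 := hd1 ⟨i, hi⟩
    have h3 := hγ' ⟨i, hi⟩
    have h4 := hd' ⟨i, hi⟩
    simp only at h3 h4
    omega
  have hsum' : ∑ i ∈ range n, α' i = ∑ i ∈ range n, β' i := by
    rw [← Fin.sum_univ_eq_sum_range, ← Fin.sum_univ_eq_sum_range]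
    simp only [hα', hβ']
    exact_mod_cast hsum
  have main := greedy_le_union n d' (fun i => d' i - α' i) (fun i => d' i - β' i)
    (fun i hi => (hbound α α' hα hα' i hi).1) (fun i hi => (hbound α α' hα hα' i hi).2)
    (fun i hi => (hbound β β' hβ hβ' i hi).1) (fun i hi => (hbound β β' hβ hβ' i hi).2)
    (fun i j hij hj => by
      have := hdmono ⟨i, by omega⟩ ⟨j, hj⟩ hij
      have h3 := hd' ⟨i, by omega⟩
      have h4 := hd' ⟨j, hj⟩
      simp only at h3 h4
      omega)
    (by simp only [sum_sub_distrib, hsum'])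
    (by
      obtain ⟨i, hi⟩ := Function.ne_iff.1 hne
      refine ⟨i, i.2, ?_⟩
      have := hα' i
      have := hβ' i
      omega)
    (k + 1) (by omega)
  rw [if_pos (by omega)] at main
  simp only [← hd', ← hα', ← hβ']
  rw [hlow (fun i => d' i - α' i), hhigh, hprod, hprod,
    Fin.prod_univ_eq_prod_range (fun i => d' i - α' i),
    Fin.prod_univ_eq_prod_range (fun i => d' i - β' i),
    Fin.prod_univ_eq_prod_range (fun i => min (d' i - α' i) (d' i - β' i))]
  have hcoef : ∑ i ∈ range (k + 1), (d' i - α' i) - ((k : ℤ) - 1) - ∑ i ∈ Ico (k + 1) n, α' i =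
      2 + ∑ i ∈ range (k + 1), (d' i - 1) - ∑ i ∈ range n, (d' i - (d' i - α' i)) := by
    simp only [sub_sub_cancel]
    rw [← sum_range_add_sum_Ico α' (show k + 1 ≤ n by omega), sum_sub_distrib, sum_sub_distrib]
    simp
    ring
  rw [hcoef]
  exact main
end

section
/- Let F_q be a finite field with q ≥ 3, let s ≥ 3, and let δ_T(d,2) denote the second generalized Hamming weight of the degree-d code on the projective torus T in ℙ^{s−1}, i.e. of the affine cartesian code C_{X*}(d) on X* = (F_q ∖ {0})^{s−1}. Let d ≥ 1 and let k ≥ 0 and 1 ≤ ℓ ≤ q−2 be the unique integers with d = k(q−2) + ℓ; set η = (q−2)(s−2) and γ = (q−2)(s−1). Then: δ_T(d,2) = (q−1)^{s−(k+3)}·[(q−1)(q−ℓ) − 1] if 1 ≤ d ≤ η; δ_T(d,2) = q − ℓ if η < d < γ; and δ_T(d,2) = 2 if d ≥ γ. -/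
open MvPolynomial Finset

/-- The `r`-th generalized Hamming weight of a linear code `C ⊆ K^ι`: the minimum support
size of an `r`-dimensional linear subcode of `C`. -/
noncomputable def GHW {K : Type*} [Field K] {ι : Type*} (C : Submodule K (ι → K)) (r : ℕ) :
    ℕ :=
  sInf {c : ℕ | ∃ D : Submodule K (ι → K), D ≤ C ∧ Module.finrank K D = r ∧
    {x : ι | ∃ v ∈ D, v x ≠ 0}.ncard = c}

/-- The degree-`d` code on the projective torus `T ⊆ ℙ^{s-1}`, realized as the affine
cartesian code on `X* = (F_q ∖ {0})^{m}` (with `m = s − 1`): the image of the space of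
polynomials of total degree at most `d` under the evaluation map at the points of `X*`. -/
noncomputable def torusCode (K : Type*) [Field K] (m d : ℕ) :
    Submodule K ({x : Fin m → K // ∀ i, x i ≠ 0} → K) :=
  (MvPolynomial.restrictTotalDegree (Fin m) K d).map
    (LinearMap.pi fun x => (MvPolynomial.aeval x.val).toLinearMap)

/-- Lower bound for a product of box side lengths `n - a i` in terms of `∑ a i`. -/
theorem pow_card_mul_le_prod {ι : Type*} {n : ℤ} (hn : 1 ≤ n) (a : ι → ℤ) (S : Finset ι)
    (h0 : ∀ i ∈ S, 0 ≤ a i) (h1 : ∀ i ∈ S, a i ≤ n - 1) (k : ℕ) (l : ℤ) (hl0 : 0 ≤ l)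
    (hl1 : l ≤ n - 1) (hsum : ∑ i ∈ S, a i ≤ k * (n - 1) + l) :
    n ^ S.card * (n - l) ≤ n ^ (k + 1) * ∏ i ∈ S, (n - a i) := by
  classical
  induction S using Finset.induction_on generalizing k l with
  | empty =>
    have := one_le_pow₀ hn (n := k)
    simp only [card_empty, pow_zero, one_mul, prod_empty, mul_one, pow_succ]
    nlinarith
  | insert j S hj ih =>
    rw [Finset.sum_insert hj] at hsum
    rw [Finset.prod_insert hj, Finset.card_insert_of_notMem hj]
    have hj0 := h0 j (mem_insert_self _ _)
    have hj1 := h1 j (mem_insert_self _ _)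
    have hS0 : ∀ i ∈ S, 0 ≤ a i := fun i hi => h0 i (mem_insert_of_mem hi)
    have hS1 : ∀ i ∈ S, a i ≤ n - 1 := fun i hi => h1 i (mem_insert_of_mem hi)
    have hp : 0 ≤ n ^ S.card := by positivity
    rcases le_or_gt (a j) l with h | h
    · have key := ih hS0 hS1 k (l - a j) (by linarith) (by linarith) (by linarith)
      calc n ^ (S.card + 1) * (n - l) = n ^ S.card * (n * (n - l)) := by ring
        _ ≤ n ^ S.card * ((n - (l - a j)) * (n - a j)) := by
            apply mul_le_mul_of_nonneg_left _ hp
            nlinarith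
        _ = (n ^ S.card * (n - (l - a j))) * (n - a j) := by ring
        _ ≤ (n ^ (k + 1) * ∏ i ∈ S, (n - a i)) * (n - a j) :=
            mul_le_mul_of_nonneg_right key (by linarith)
        _ = _ := by ring
    · have hs : 0 ≤ ∑ i ∈ S, a i := Finset.sum_nonneg hS0
      obtain _ | k := k
      · simp only [Nat.cast_zero, zero_mul, zero_add] at hsum
        linarith
      have key := ih hS0 hS1 k (n - 1 + l - a j) (by linarith) (by linarith)
        (by push_cast at hsum; linarith)
      calc n ^ (S.card + 1) * (n - l) = n ^ S.card * (n * (n - l)) := by ring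
        _ ≤ n ^ S.card * (n * ((n - (n - 1 + l - a j)) * (n - a j))) := by
            apply mul_le_mul_of_nonneg_left _ hp
            apply mul_le_mul_of_nonneg_left _ (by linarith)
            nlinarith
        _ = (n ^ S.card * (n - (n - 1 + l - a j))) * (n * (n - a j)) := by ring
        _ ≤ (n ^ (k + 1) * ∏ i ∈ S, (n - a i)) * (n * (n - a j)) :=
            mul_le_mul_of_nonneg_right key (mul_nonneg (by linarith) (by linarith))
        _ = _ := by ring

/-- Lower bound for the size of the union of two boxes with side lengths `n - a i` and `n - b i`,
the second of which sticks out of the first in direction `j`. -/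
theorem pow_card_mul_le_two_boxes {ι : Type*} [DecidableEq ι] {n : ℤ} (hn : 2 ≤ n)
    (a b : ι → ℤ) (S : Finset ι) {j : ι} (hj : j ∈ S)
    (ha0 : ∀ i ∈ S, 0 ≤ a i) (ha1 : ∀ i ∈ S, a i ≤ n - 1)
    (hb0 : ∀ i ∈ S, 0 ≤ b i) (hb1 : ∀ i ∈ S, b i ≤ n - 1) (hab : b j < a j)
    (k : ℕ) (l : ℤ) (hl0 : 1 ≤ l) (hl1 : l ≤ n - 1)
    (ha : ∑ i ∈ S, a i ≤ k * (n - 1) + l) (hb : ∑ i ∈ S, b i ≤ k * (n - 1) + l) :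
    n ^ S.card * (n * (n + 1 - l) - 1) ≤
      n ^ (k + 2) * (∏ i ∈ S, (n - a i) + (a j - b j) * ∏ i ∈ S.erase j, (n - b i)) := by
  have hcard : n ^ S.card = n ^ (S.erase j).card * n := by
    rw [← pow_succ, Finset.card_erase_add_one hj]
  have haE0 : ∀ i ∈ S.erase j, 0 ≤ a i := fun i hi => ha0 i (mem_of_mem_erase hi)
  have haE1 : ∀ i ∈ S.erase j, a i ≤ n - 1 := fun i hi => ha1 i (mem_of_mem_erase hi)
  have hbE0 : ∀ i ∈ S.erase j, 0 ≤ b i := fun i hi => hb0 i (mem_of_mem_erase hi)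
  have hbE1 : ∀ i ∈ S.erase j, b i ≤ n - 1 := fun i hi => hb1 i (mem_of_mem_erase hi)
  have hsa := Finset.add_sum_erase S a hj
  have hsb := Finset.add_sum_erase S b hj
  have hpa := Finset.mul_prod_erase S (fun i => n - a i) hj
  have hj0 := hb0 j hj
  have hj1 := ha1 j hj
  have hN : 0 ≤ n ^ (S.erase j).card := by positivity
  set N := n ^ (S.erase j).card
  set Q := ∏ i ∈ S.erase j, (n - b i)
  rw [hcard]
  rcases le_or_gt (l - 1) (b j) with h | h
  · have h1 := pow_card_mul_le_prod (by linarith) a S ha0 ha1 k l (by linarith) hl1 ha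
    have h2 := pow_card_mul_le_prod (by linarith) b _ hbE0 hbE1 k 1 (by linarith) (by linarith)
      (by linarith)
    rw [hcard] at h1
    have hQ : 0 ≤ n ^ (k + 1) * Q := le_trans (mul_nonneg hN (by linarith)) h2
    have h3 : n ^ (k + 1) * Q ≤ (a j - b j) * (n ^ (k + 1) * Q) := by nlinarith
    have h4 : N * (n - 1) ≤ (a j - b j) * (n ^ (k + 1) * Q) := h2.trans h3
    calc N * n * (n * (n + 1 - l) - 1) = n * (N * n * (n - l) + N * (n - 1)) := by ring
      _ ≤ n * (n ^ (k + 1) * ∏ i ∈ S, (n - a i) + (a j - b j) * (n ^ (k + 1) * Q)) :=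
          mul_le_mul_of_nonneg_left (add_le_add h1 h4) (by linarith)
      _ = _ := by ring
  · have h2 : N * (n - (l - b j)) ≤ n ^ (k + 1) * Q :=
      pow_card_mul_le_prod (by linarith) b _ hbE0 hbE1 k (l - b j) (by linarith)
        (by linarith) (by linarith)
    have h4 : N * ((n - (l - b j)) * (a j - b j)) ≤ n ^ (k + 1) * Q * (a j - b j) := by
      rw [← mul_assoc]
      exact mul_le_mul_of_nonneg_right h2 (by linarith)
    set P := ∏ i ∈ S.erase j, (n - a i)
    suffices hU : ∃ x : ℤ, N * x ≤ n ^ (k + 1) * ((n - a j) * P) ∧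
        n * (n + 1 - l) - 1 ≤ x + (n - (l - b j)) * (a j - b j) by
      obtain ⟨x, hx1, hx2⟩ := hU
      rw [← hpa]
      calc N * n * (n * (n + 1 - l) - 1) = n * (N * (n * (n + 1 - l) - 1)) := by ring
        _ ≤ n * (N * (x + (n - (l - b j)) * (a j - b j))) :=
            mul_le_mul_of_nonneg_left (mul_le_mul_of_nonneg_left hx2 hN) (by linarith)
        _ = n * (N * x + N * ((n - (l - b j)) * (a j - b j))) := by ring
        _ ≤ n * (n ^ (k + 1) * ((n - a j) * P) + n ^ (k + 1) * Q * (a j - b j)) :=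
            mul_le_mul_of_nonneg_left (add_le_add hx1 h4) (by linarith)
        _ = _ := by ring
    rcases lt_or_ge (a j) l with h' | h'
    · have h1 : N * (n - (l - a j)) ≤ n ^ (k + 1) * P :=
        pow_card_mul_le_prod (by linarith) a _ haE0 haE1 k (l - a j) (by linarith)
          (by linarith) (by linarith)
      refine ⟨(n - (l - a j)) * (n - a j), ?_, ?_⟩
      · calc N * ((n - (l - a j)) * (n - a j)) = N * (n - (l - a j)) * (n - a j) := by ring
          _ ≤ n ^ (k + 1) * P * (n - a j) := mul_le_mul_of_nonneg_right h1 (by linarith)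
          _ = _ := by ring
      · generalize a j = x at *
        generalize b j = y at *
        nlinarith [mul_nonneg hj0 (by linarith : 0 ≤ x - 1 - y),
          mul_nonneg (by linarith : 0 ≤ x - 1) (by linarith : 0 ≤ n - 1 - x),
          mul_nonneg hj0 (by linarith : 0 ≤ l - 1 - x)]
    · have hE := Finset.sum_nonneg haE0
      have h1 : N * n * (1 + a j - l) ≤ n ^ (k + 1) * P := by
        obtain _ | k := k
        · have := pow_card_mul_le_prod (by linarith) a _ haE0 haE1 0 0 (by linarith)
            (by linarith) (by push_cast at ha ⊢; linarith)
          have hal : a j = l := by push_cast at ha; linarith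
          rw [hal]
          simpa [N, P] using this
        · have := pow_card_mul_le_prod (by linarith) a _ haE0 haE1 k (n - 1 + l - a j)
            (by linarith) (by linarith) (by push_cast at ha ⊢; linarith)
          calc N * n * (1 + a j - l) = n * (N * (n - (n - 1 + l - a j))) := by ring
            _ ≤ n * (n ^ (k + 1) * P) := mul_le_mul_of_nonneg_left this (by linarith)
            _ = _ := by ring
      refine ⟨n * (1 + a j - l) * (n - a j), ?_, ?_⟩
      · calc N * (n * (1 + a j - l) * (n - a j)) = N * n * (1 + a j - l) * (n - a j) := by ring
          _ ≤ n ^ (k + 1) * P * (n - a j) := mul_le_mul_of_nonneg_right h1 (by linarith)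
          _ = _ := by ring
      · generalize a j = x at *
        generalize b j = y at *
        have e1 : n * (n - l) ≤ n * ((1 + x - l) * (n - x)) := by
          apply mul_le_mul_of_nonneg_left _ (by linarith)
          nlinarith
        have e2 : n - 1 ≤ (n - (l - y)) * (x - y) := by
          have : (n - (l - y)) * (l - y) ≤ (n - (l - y)) * (x - y) :=
            mul_le_mul_of_nonneg_left (by linarith) (by linarith)
          nlinarith [mul_nonneg (by linarith : 0 ≤ l - y - 1) (by linarith : 0 ≤ n - 1 - (l - y))]
        linarith

/-- Polynomials with pairwise distinct leading monomials lying in the box `[0, q - 2]^m` that all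
vanish on the torus outside `Z` are at most `|Z|` in number. -/
theorem card_le_ncard_of_injective_degree {K : Type*} [Field K] [Fintype K] {m : ℕ}
    {ι : Type*} [Fintype ι] (h : ι → MvPolynomial (Fin m) K) (h0 : ∀ c, h c ≠ 0)
    (hinj : Function.Injective fun c => MonomialOrder.degLex.degree (h c))
    (hbox : ∀ c i, MonomialOrder.degLex.degree (h c) i < Fintype.card K - 1)
    (Z : Set {x : Fin m → K // ∀ i, x i ≠ 0})
    (hZ : ∀ c, ∀ x ∉ Z, eval x.val (h c) = 0) :
    Fintype.card ι ≤ Z.ncard := by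
  classical
  have hli : LinearIndependent K fun c => (fun x : Z => eval x.val.val (h c) : Z → K) := by
    rw [Fintype.linearIndependent_iff]
    intro g hg
    by_contra! hne
    obtain ⟨c₁, hc₁⟩ := hne
    obtain ⟨c₀, hc₀, hmax⟩ := Finset.exists_max_image (univ.filter fun c => g c ≠ 0)
      (fun c => MonomialOrder.degLex.toSyn (MonomialOrder.degLex.degree (h c)))
      ⟨c₁, by simpa using hc₁⟩
    simp only [mem_filter, mem_univ, true_and] at hc₀ hmax
    set H := ∑ c, C (g c) * h c with hH
    have hcoeff : H.coeff (MonomialOrder.degLex.degree (h c₀)) ≠ 0 := by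
      rw [hH, coeff_sum, Finset.sum_eq_single c₀]
      · rw [coeff_C_mul]
        exact mul_ne_zero hc₀ (MonomialOrder.degLex.coeff_degree_ne_zero_iff.2 (h0 c₀))
      · intro c _ hc
        rw [coeff_C_mul]
        by_cases hgc : g c = 0
        · simp [hgc]
        rw [MonomialOrder.coeff_eq_zero_of_lt, mul_zero]
        refine lt_of_le_of_ne (hmax c hgc) fun he => hc (hinj ?_)
        exact MonomialOrder.degLex.toSyn.injective he
      · simp
    have hdeg : H.totalDegree = (MonomialOrder.degLex.degree (h c₀)).degree := by
      apply le_antisymm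
      · refine totalDegree_finsetSum_le fun c _ => ?_
        by_cases hgc : g c = 0
        · simp [hgc]
        rw [degree_degLexDegree]
        refine (totalDegree_mul _ _).trans ?_
        rw [totalDegree_C, zero_add]
        exact degLex_totalDegree_monotone (hmax c hgc)
      · exact le_totalDegree (mem_support_iff.2 hcoeff)
    obtain ⟨x, hx, hxH⟩ := combinatorial_nullstellensatz_exists_eval_nonzero H _ hcoeff hdeg
      (fun _ => univ.erase (0 : K)) (by simpa using hbox c₀)
    apply hxH
    let y : {x : Fin m → K // ∀ i, x i ≠ 0} := ⟨x, by simpa using hx⟩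
    by_cases hy : y ∈ Z
    · have := congrFun hg ⟨y, hy⟩
      simpa [hH, y] using this
    · rw [hH, map_sum]
      refine Finset.sum_eq_zero fun c _ => ?_
      rw [map_mul, hZ c y hy, mul_zero]
  have := hli.fintype_card_le_finrank
  rwa [Module.finrank_fintype_fun_eq_card, ← Set.toFinset_card,
    ← Set.ncard_eq_toFinset_card'] at this

/-- On the torus every polynomial agrees with one of no larger total degree, all of whose partial
degrees are at most `q - 2`. -/
theorem exists_reduced_eval_eq {K : Type*} [Field K] [Fintype K] (hq : 2 ≤ Fintype.card K)
    {m d : ℕ} (f : MvPolynomial (Fin m) K) (hf : f.totalDegree ≤ d) :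
    ∃ g ∈ restrictTotalDegree (Fin m) K d ⊓ restrictDegree (Fin m) K (Fintype.card K - 2),
      ∀ x : Fin m → K, (∀ i, x i ≠ 0) → eval x g = eval x f := by
  classical
  let r : (Fin m →₀ ℕ) → (Fin m →₀ ℕ) :=
    fun c => c.mapRange (· % (Fintype.card K - 1)) (Nat.zero_mod _)
  refine ⟨∑ c ∈ f.support, monomial (r c) (f.coeff c), Submodule.sum_mem _ fun c hc => ?_, ?_⟩
  · have hr : r c ≤ c := fun i => Nat.mod_le _ _
    refine Submodule.mem_inf.2 ⟨?_, ?_⟩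
    · rw [mem_restrictTotalDegree]
      refine (totalDegree_monomial_le _ _).trans (le_trans ?_ ((le_totalDegree hc).trans hf))
      exact Finsupp.degree_mono hr
    · rw [mem_restrictDegree]
      intro e he i
      have := support_monomial_subset he
      rw [mem_singleton] at this
      subst this
      have : c i % (Fintype.card K - 1) < Fintype.card K - 1 := Nat.mod_lt _ (by omega)
      simp only [r, Finsupp.mapRange_apply]
      omega
  · intro x hx
    rw [map_sum]
    conv_rhs => rw [f.as_sum, map_sum]
    refine Finset.sum_congr rfl fun c _ => ?_
    rw [eval_monomial, eval_monomial, Finsupp.prod_fintype _ _ (by simp),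
      Finsupp.prod_fintype _ _ (by simp)]
    congr 1
    refine Finset.prod_congr rfl fun i _ => ?_
    simp only [r, Finsupp.mapRange_apply]
    conv_rhs => rw [← Nat.mod_add_div (c i) (Fintype.card K - 1), pow_add, pow_mul,
      FiniteField.pow_card_sub_one_eq_one _ (hx i), one_pow, mul_one]

/-- The footprint bound for two polynomials whose leading exponents `a`, `b` satisfy `b j < a j`. -/
theorem footprint_two {K : Type*} [Field K] [Fintype K] {m : ℕ}
    (f g : MvPolynomial (Fin m) K) (hf : f ≠ 0) (hg : g ≠ 0)
    (a b : Fin m →₀ ℕ) (hfa : MonomialOrder.degLex.degree f = a)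
    (hgb : MonomialOrder.degLex.degree g = b) {j : Fin m} (hj : b j < a j)
    (ha : ∀ i, a i < Fintype.card K - 1)
    (Z : Set {x : Fin m → K // ∀ i, x i ≠ 0})
    (hfZ : ∀ x ∉ Z, eval x.val f = 0) (hgZ : ∀ x ∉ Z, eval x.val g = 0) :
    ∏ i, (Fintype.card K - 1 - a i) +
      (a j - b j) * ∏ i ∈ univ.erase j, (Fintype.card K - 1 - b i) ≤ Z.ncard := by
  classical
  set n := Fintype.card K - 1
  let U : Finset (Fin m → ℕ) := Fintype.piFinset fun i => Finset.Ico (a i) n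
  let V : Finset (Fin m → ℕ) :=
    Fintype.piFinset fun i => Finset.Ico (b i) (if i = j then a j else n)
  have hU : ∀ c ∈ U, a ≤ Finsupp.equivFunOnFinite.symm c ∧ ∀ i, c i < n := by
    intro c hc
    simp only [U, Fintype.mem_piFinset, Finset.mem_Ico] at hc
    exact ⟨fun i => (hc i).1, fun i => (hc i).2⟩
  have hV : ∀ c ∈ V, b ≤ Finsupp.equivFunOnFinite.symm c ∧ (∀ i, c i < n) ∧ c j < a j := by
    intro c hc
    simp only [V, Fintype.mem_piFinset, Finset.mem_Ico] at hc
    have hcj : c j < a j := by simpa using (hc j).2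
    refine ⟨fun i => (hc i).1, fun i => ?_, hcj⟩
    by_cases hij : i = j
    · subst hij
      exact hcj.trans (ha i)
    · simpa [hij] using (hc i).2
  have hdisj : Disjoint U V := by
    rw [Finset.disjoint_left]
    intro c hcU hcV
    exact absurd ((hU c hcU).1 j) (not_le.2 (hV c hcV).2.2)
  have hcard : (U ∪ V).card = ∏ i, (n - a i) + (a j - b j) * ∏ i ∈ univ.erase j, (n - b i) := by
    rw [Finset.card_union_of_disjoint hdisj, Fintype.card_piFinset, Fintype.card_piFinset]
    simp only [Nat.card_Ico]
    congr 1
    rw [← Finset.mul_prod_erase _ _ (mem_univ j), if_pos rfl]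
    congr 1
    refine Finset.prod_congr rfl fun i hi => ?_
    rw [if_neg (Finset.ne_of_mem_erase hi)]
  rw [← hcard, ← Fintype.card_coe]
  let h : (U ∪ V : Finset (Fin m → ℕ)) → MvPolynomial (Fin m) K := fun c =>
    if c.1 ∈ U then monomial (Finsupp.equivFunOnFinite.symm c.1 - a) 1 * f
    else monomial (Finsupp.equivFunOnFinite.symm c.1 - b) 1 * g
  have hmon : ∀ e : Fin m →₀ ℕ, (monomial e (1 : K)) ≠ 0 := by simp
  have hh0 : ∀ c, h c ≠ 0 := by
    intro c
    simp only [h]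
    split_ifs
    · exact mul_ne_zero (hmon _) hf
    · exact mul_ne_zero (hmon _) hg
  have hhd : ∀ c, MonomialOrder.degLex.degree (h c) = Finsupp.equivFunOnFinite.symm c.1 := by
    intro c
    simp only [h]
    split_ifs with hc
    · rw [MonomialOrder.degree_mul (hmon _) hf, MonomialOrder.degree_monomial, if_neg one_ne_zero,
        hfa, tsub_add_cancel_of_le (hU _ hc).1]
    · rw [MonomialOrder.degree_mul (hmon _) hg, MonomialOrder.degree_monomial, if_neg one_ne_zero,
        hgb, tsub_add_cancel_of_le (hV _ ((Finset.mem_union.1 c.2).resolve_left hc)).1]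
  refine card_le_ncard_of_injective_degree h hh0 ?_ ?_ Z ?_
  · intro c c' hcc
    simp only [hhd] at hcc
    exact Subtype.ext (Finsupp.equivFunOnFinite.symm.injective hcc)
  · intro c i
    rw [hhd]
    rcases Finset.mem_union.1 c.2 with hc | hc
    · exact (hU _ hc).2 i
    · exact (hV _ hc).2.1 i
  · intro c x hx
    simp only [h]
    split_ifs
    · rw [map_mul, hfZ x hx, mul_zero]
    · rw [map_mul, hgZ x hx, mul_zero]

/-- A two-dimensional subcode of the torus code contains the values of two reduced polynomials with
distinct leading monomials. -/
theorem exists_reduced_pair {K : Type*} [Field K] [Fintype K] (hq : 2 ≤ Fintype.card K)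
    {m d : ℕ} (D : Submodule K ({x : Fin m → K // ∀ i, x i ≠ 0} → K))
    (hD : D ≤ torusCode K m d) (hD2 : Module.finrank K D = 2) :
    ∃ f ∈ restrictTotalDegree (Fin m) K d ⊓ restrictDegree (Fin m) K (Fintype.card K - 2),
    ∃ g ∈ restrictTotalDegree (Fin m) K d ⊓ restrictDegree (Fin m) K (Fintype.card K - 2),
      f ≠ 0 ∧ g ≠ 0 ∧ MonomialOrder.degLex.degree f ≠ MonomialOrder.degLex.degree g ∧
      (fun x => eval x.val f) ∈ D ∧ (fun x => eval x.val g) ∈ D := by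
  classical
  have hrep : ∀ v ∈ D, ∃ f ∈ restrictTotalDegree (Fin m) K d ⊓
      restrictDegree (Fin m) K (Fintype.card K - 2), (fun x => eval x.val f) = v := by
    intro v hv
    obtain ⟨f, hf, rfl⟩ := Submodule.mem_map.1 (hD hv)
    obtain ⟨g, hg, hgf⟩ := exists_reduced_eval_eq hq f ((mem_restrictTotalDegree _ _ _).1 hf)
    refine ⟨g, hg, funext fun x => ?_⟩
    rw [hgf x.val x.2]
    simp
  let B := Module.finBasisOfFinrankEq K D hD2
  obtain ⟨f, hf, hfv⟩ := hrep _ (B 0).2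
  obtain ⟨g, hg, hgv⟩ := hrep _ (B 1).2
  have hind : ∀ s t : K, s • (B 0).1 + t • (B 1).1 = 0 → s = 0 ∧ t = 0 := by
    have hli := B.linearIndependent
    have : B = ![B 0, B 1] := by ext i; fin_cases i <;> rfl
    rw [this, LinearIndependent.pair_iff] at hli
    intro s t hst
    exact hli s t (Subtype.ext hst)
  have hf0 : f ≠ 0 := by
    rintro rfl
    have := hind 1 0 (by rw [← hfv]; ext; simp)
    simp at this
  have hg0 : g ≠ 0 := by
    rintro rfl
    have := hind 0 1 (by rw [← hgv]; ext; simp)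
    simp at this
  by_cases hne : MonomialOrder.degLex.degree f = MonomialOrder.degLex.degree g
  swap
  · exact ⟨f, hf, g, hg, hf0, hg0, hne, hfv ▸ (B 0).2, hgv ▸ (B 1).2⟩
  set t := MonomialOrder.degLex.degree f with ht
  have hcf : f.coeff t ≠ 0 := MonomialOrder.degLex.coeff_degree_ne_zero_iff.2 hf0
  set p := g.coeff t • f - f.coeff t • g with hp
  have hpv : (fun x : {x : Fin m → K // ∀ i, x i ≠ 0} => eval x.val p)
      = g.coeff t • (B 0).1 - f.coeff t • (B 1).1 := by
    rw [← hfv, ← hgv]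
    ext x
    simp [hp, smul_eval]
  have hp0 : p ≠ 0 := by
    intro h
    have := hind (g.coeff t) (-f.coeff t) (by
      rw [neg_smul, ← sub_eq_add_neg, ← hpv, h]
      ext
      simp)
    exact hcf (neg_eq_zero.1 this.2)
  refine ⟨f, hf, p, Submodule.sub_mem _ (Submodule.smul_mem _ _ hf) (Submodule.smul_mem _ _ hg),
    hf0, hp0, fun he => ?_, hfv ▸ (B 0).2, ?_⟩
  · apply MonomialOrder.degLex.coeff_degree_ne_zero_iff.2 hp0
    rw [← he, hp, coeff_sub, coeff_smul, coeff_smul, smul_eq_mul, smul_eq_mul, ← ht]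
    ring
  · rw [hpv]
    exact D.sub_mem (D.smul_mem _ (B 0).2) (D.smul_mem _ (B 1).2)

/-- Every two-dimensional subcode of the torus code gives rise to a pair of boxes whose union is no
larger than the support of the subcode. -/
theorem exists_boxes {K : Type*} [Field K] [Fintype K] (hq : 3 ≤ Fintype.card K)
    {m d : ℕ} (D : Submodule K ({x : Fin m → K // ∀ i, x i ≠ 0} → K))
    (hD : D ≤ torusCode K m d) (hD2 : Module.finrank K D = 2) :
    ∃ (a b : Fin m → ℤ) (j : Fin m), (∀ i, 0 ≤ a i) ∧ (∀ i, a i ≤ (Fintype.card K : ℤ) - 1 - 1) ∧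
      (∀ i, 0 ≤ b i) ∧ (∀ i, b i ≤ (Fintype.card K : ℤ) - 1 - 1) ∧
      ∑ i, a i ≤ d ∧ ∑ i, b i ≤ d ∧ b j < a j ∧
      ∏ i, ((Fintype.card K : ℤ) - 1 - a i) +
        (a j - b j) * ∏ i ∈ univ.erase j, ((Fintype.card K : ℤ) - 1 - b i) ≤
        ({x | ∃ v ∈ D, v x ≠ 0}.ncard : ℤ) := by
  classical
  obtain ⟨f, hf, g, hg, hf0, hg0, hne, hfD, hgD⟩ := exists_reduced_pair (by omega) D hD hD2
  obtain ⟨j, hj⟩ : ∃ j, MonomialOrder.degLex.degree f j ≠ MonomialOrder.degLex.degree g j := by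
    by_contra! h
    exact hne (Finsupp.ext h)
  wlog hlt : MonomialOrder.degLex.degree g j < MonomialOrder.degLex.degree f j generalizing f g
  · exact this g hg f hf hg0 hf0 hne.symm hgD hfD hj.symm (by omega)
  have hbox : ∀ p ∈ restrictTotalDegree (Fin m) K d ⊓ restrictDegree (Fin m) K (Fintype.card K - 2),
      p ≠ 0 → (∀ i, MonomialOrder.degLex.degree p i ≤ Fintype.card K - 2) ∧
        ∑ i, MonomialOrder.degLex.degree p i ≤ d := by
    intro p hp hp0
    obtain ⟨hp1, hp2⟩ := Submodule.mem_inf.1 hp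
    have hmem := MonomialOrder.degLex.degree_mem_support hp0
    refine ⟨fun i => (mem_restrictDegree _ _ _).1 hp2 _ hmem i, ?_⟩
    rw [← Finsupp.degree_eq_sum, degree_degLexDegree]
    exact (mem_restrictTotalDegree _ _ _).1 hp1
  obtain ⟨ha, hsa⟩ := hbox f hf hf0
  obtain ⟨hb, hsb⟩ := hbox g hg hg0
  have key := footprint_two f g hf0 hg0 _ _ rfl rfl hlt
    (fun i => lt_of_le_of_lt (ha i) (by omega)) {x | ∃ v ∈ D, v x ≠ 0}
    (fun x hx => by by_contra h; exact hx ⟨_, hfD, h⟩)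
    (fun x hx => by by_contra h; exact hx ⟨_, hgD, h⟩)
  set a := MonomialOrder.degLex.degree f
  set b := MonomialOrder.degLex.degree g
  have hca : ∀ i, ((Fintype.card K - 1 - a i : ℕ) : ℤ) = (Fintype.card K : ℤ) - 1 - a i := by
    intro i
    have := ha i
    omega
  have hcb : ∀ i, ((Fintype.card K - 1 - b i : ℕ) : ℤ) = (Fintype.card K : ℤ) - 1 - b i := by
    intro i
    have := hb i
    omega
  refine ⟨fun i => a i, fun i => b i, j, fun i => by positivity, fun i => ?_,
    fun i => by positivity, fun i => ?_, ?_, ?_, Int.ofNat_lt.2 hlt, ?_⟩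
  · have := ha i
    dsimp only
    omega
  · have := hb i
    dsimp only
    omega
  · dsimp only
    exact_mod_cast hsa
  · dsimp only
    exact_mod_cast hsb
  · zify [hlt.le] at key
    simpa only [Nat.cast_prod, hca, hcb] using key

/-- A two-dimensional subcode of the torus code spanned by products of linear forms `X i - C c`,
with a description of its support. -/
theorem exists_subcode_ncard_le_card {K : Type*} [Field K] [Fintype K] [DecidableEq K] {m d : ℕ}
    (A : Fin m → Finset K) (i₁ i₂ : Fin m) (c₁ c₂ : K) (hd : ∑ i, (A i).card + 1 ≤ d)
    (x y : Fin m → K) (hx : ∀ i, x i ≠ 0 ∧ x i ∉ A i) (hy : ∀ i, y i ≠ 0 ∧ y i ∉ A i)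
    (hx₁ : x i₁ = c₁) (hx₂ : x i₂ ≠ c₂) (hy₁ : y i₁ ≠ c₁) (hy₂ : y i₂ = c₂) :
    ∃ D ≤ torusCode K m d, Module.finrank K D = 2 ∧
      {x | ∃ v ∈ D, v x ≠ 0}.ncard ≤ (univ.filter fun z : Fin m → K =>
      (∀ i, z i ≠ 0 ∧ z i ∉ A i) ∧ (z i₁ ≠ c₁ ∨ z i₂ ≠ c₂)).card := by
  let p : MvPolynomial (Fin m) K := ∏ i, ∏ c ∈ A i, (X i - C c)
  have hp : ∀ z : Fin m → K, eval z p ≠ 0 ↔ ∀ i, z i ∉ A i := by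
    intro z
    simp only [p, map_prod, map_sub, eval_X, eval_C, Finset.prod_ne_zero_iff, mem_univ,
      true_implies, sub_ne_zero]
    exact ⟨fun h i hi => h i _ hi rfl, fun h i c hc he => h i (he ▸ hc)⟩
  have hlin : ∀ (i : Fin m) (c : K), (X i - C c : MvPolynomial (Fin m) K).totalDegree ≤ 1 := by
    intro i c
    refine (totalDegree_sub_C_le _ _).trans ?_
    rw [totalDegree_X]
  have hpd : p.totalDegree ≤ ∑ i, (A i).card := by
    refine (totalDegree_finsetProd _ _).trans (Finset.sum_le_sum fun i _ => ?_)
    refine (totalDegree_finsetProd _ _).trans ?_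
    refine (Finset.sum_le_card_nsmul _ _ 1 fun c _ => hlin i c).trans ?_
    simp
  let w : Fin m → K → ({x : Fin m → K // ∀ i, x i ≠ 0} → K) :=
    fun i c z => eval z.val (p * (X i - C c))
  have hw : ∀ i c, w i c ∈ torusCode K m d := by
    intro i c
    refine Submodule.mem_map.2 ⟨p * (X i - C c), ?_, ?_⟩
    · rw [mem_restrictTotalDegree]
      exact (totalDegree_mul _ _).trans ((add_le_add hpd (hlin i c)).trans hd)
    · ext z
      simp [w]
  have hwz : ∀ i c z, w i c z = eval z.val p * (z.val i - c) := by
    intro i c z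
    simp [w]
  have hli : LinearIndependent K ![w i₁ c₁, w i₂ c₂] := by
    rw [LinearIndependent.pair_iff]
    intro s t hst
    have ex := congrFun hst ⟨x, fun i => (hx i).1⟩
    have ey := congrFun hst ⟨y, fun i => (hy i).1⟩
    have hpx := (hp x).2 fun i => (hx i).2
    have hpy := (hp y).2 fun i => (hy i).2
    simp only [Pi.add_apply, Pi.smul_apply, hwz, hx₁, hy₂, sub_self, mul_zero, smul_eq_mul,
      zero_add, add_zero, Pi.zero_apply] at ex ey
    have h1 : y i₁ - c₁ ≠ 0 := sub_ne_zero.2 hy₁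
    have h2 : x i₂ - c₂ ≠ 0 := sub_ne_zero.2 hx₂
    constructor
    · simpa [hpy, h1] using ey
    · simpa [hpx, h2] using ex
  let D := Submodule.span K (Set.range ![w i₁ c₁, w i₂ c₂])
  have hDC : D ≤ torusCode K m d := by
    refine Submodule.span_le.2 ?_
    rintro _ ⟨i, rfl⟩
    fin_cases i
    · exact hw _ _
    · exact hw _ _
  have hD2 : Module.finrank K D = 2 := by
    rw [finrank_span_eq_card hli, Fintype.card_fin]
  refine ⟨D, hDC, hD2, ?_⟩
  rw [← Set.ncard_image_of_injective _ Subtype.val_injective, ← Set.ncard_coe_finset]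
  refine Set.ncard_le_ncard ?_ (Finset.finite_toSet _)
  rintro _ ⟨z, ⟨v, hv, hvz⟩, rfl⟩
  simp only [D, Matrix.range_cons, Matrix.range_empty, Set.union_empty, Set.singleton_union] at hv
  obtain ⟨s, t, rfl⟩ := Submodule.mem_span_pair.1 hv
  simp only [Pi.add_apply, Pi.smul_apply, hwz, smul_eq_mul] at hvz
  simp only [coe_filter, mem_univ, true_and, Set.mem_ofPred_eq]
  have hpz : eval z.val p ≠ 0 := fun h => hvz (by simp [h])
  refine ⟨fun i => ⟨z.2 i, (hp _).1 hpz i⟩, ?_⟩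
  by_contra! h
  exact hvz (by simp [h.1, h.2])

theorem prod_ite_mem_ite_eq {m : ℕ} (S : Finset (Fin m)) {j : Fin m} (hj : j ∉ S) (α n : ℕ) :
    ∏ i, (if i ∈ S then 1 else if i = j then α else n) = α * n ^ (m - S.card - 1) := by
  have hj' : j ∈ Sᶜ := Finset.mem_compl.2 hj
  rw [Finset.prod_ite, Finset.prod_const_one, one_mul, Finset.filter_notMem_eq_sdiff,
    ← Finset.compl_eq_univ_sdiff, ← Finset.mul_prod_erase _ _ hj', if_pos rfl]
  congr 1
  rw [Finset.prod_congr rfl fun i hi => if_neg (Finset.ne_of_mem_erase hi), Finset.prod_const,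
    Finset.card_erase_of_mem hj', Finset.card_compl, Fintype.card_fin]

/-- Two-dimensional subcodes of the torus code with small support, for `k = m - 1` and for
`k < m - 1`. -/
theorem exists_subcode_ncard_le {K : Type*} [Field K] [Fintype K] (hq : 3 ≤ Fintype.card K)
    {m d k l : ℕ} (hl1 : 1 ≤ l) (hl2 : l ≤ Fintype.card K - 2)
    (hd : k * (Fintype.card K - 2) + l ≤ d) (hk : k < m) :
    (k + 1 = m → ∃ D ≤ torusCode K m d, Module.finrank K D = 2 ∧
      {x | ∃ v ∈ D, v x ≠ 0}.ncard ≤ Fintype.card K - l) ∧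
    (k + 1 < m → ∃ D ≤ torusCode K m d, Module.finrank K D = 2 ∧
      {x | ∃ v ∈ D, v x ≠ 0}.ncard ≤
        (Fintype.card K - l) * (Fintype.card K - 1) ^ (m - k - 1) -
          (Fintype.card K - 1) ^ (m - k - 2)) := by
  classical
  have hF : (univ.erase (0 : K)).card = Fintype.card K - 1 := by simp
  obtain ⟨B, hBsub, hBcard⟩ := Finset.exists_subset_card_eq
    (s := univ.erase (0 : K)) (n := l - 1) (by omega)
  have hFB : (univ.erase (0 : K) \ B).card = Fintype.card K - l := by
    rw [Finset.card_sdiff_of_subset hBsub, hF, hBcard]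
    omega
  obtain ⟨c, hc, e, he, hce⟩ := Finset.one_lt_card.1 (show 1 < (univ.erase (0 : K) \ B).card by
    omega)
  simp only [mem_sdiff, mem_erase, mem_univ, and_true] at hc he
  let j : Fin m := ⟨k, hk⟩
  let S : Finset (Fin m) := Finset.Iio j
  have hS : S.card = k := by simp [S, j]
  have hjS : j ∉ S := by simp [S]
  let A : Fin m → Finset K := fun i =>
    if i ∈ S then (univ.erase 0).erase 1 else if i = j then B else ∅
  let W : Fin m → Finset K := fun i =>
    if i ∈ S then {1} else if i = j then univ.erase 0 \ B else univ.erase 0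
  have hAW : ∀ i (u : K), (u ≠ 0 ∧ u ∉ A i) ↔ u ∈ W i := by
    intro i u
    simp only [A, W]
    split_ifs
    · by_cases hu : u = 1 <;> simp [hu]
    · simp
    · simp
  have hA : ∑ i, (A i).card + 1 ≤ d := by
    have h1 : ∀ i, (A i).card = if i ∈ S then Fintype.card K - 2 else if i = j then l - 1 else 0 := by
      intro i
      simp only [A]
      split_ifs
      · rw [Finset.card_erase_of_mem (by simp), hF]
        omega
      · exact hBcard
      · simp
    simp_rw [h1]
    rw [Finset.sum_ite, Finset.sum_const, Finset.filter_univ_mem, hS, Finset.sum_ite_eq',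
      if_pos (by simpa using hjS), smul_eq_mul]
    omega
  have hW : (Fintype.piFinset W).card =
      (Fintype.card K - l) * (Fintype.card K - 1) ^ (m - k - 1) := by
    rw [Fintype.card_piFinset, ← hS, ← prod_ite_mem_ite_eq S hjS]
    refine Finset.prod_congr rfl fun i _ => ?_
    simp only [W]
    split_ifs
    · simp
    · exact hFB
    · exact hF
  have hjW : ∀ u : K, u ≠ 0 ∧ u ∉ B → ∀ t : K, t ≠ 0 → ∀ i,
      (if i ∈ S then 1 else if i = j then u else t) ∈ W i := by
    intro u hu t ht i
    simp only [W]
    split_ifs <;> simp [hu, ht]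
  constructor
  · intro hkm
    obtain ⟨D, hD, hD2, hsupp⟩ := exists_subcode_ncard_le_card A j j c e hA _ _
      (fun i => (hAW i _).2 (hjW c hc 1 one_ne_zero i))
      (fun i => (hAW i _).2 (hjW e he 1 one_ne_zero i)) (by simp [hjS])
      (by simpa [hjS] using hce) (by simpa [hjS] using hce.symm) (by simp [hjS])
    refine ⟨D, hD, hD2, hsupp.trans ?_⟩
    have : m - k - 1 = 0 := by omega
    rw [this, pow_zero, mul_one] at hW
    rw [← hW]
    refine Finset.card_le_card fun z hz => ?_
    simp only [mem_filter, mem_univ, true_and, hAW] at hz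
    exact Fintype.mem_piFinset.2 hz.1
  · intro hkm
    let j' : Fin m := ⟨k + 1, hkm⟩
    have hj'S : j' ∉ S := by simp [S, j, j']
    have hjj' : j' ≠ j := by simp [j, j']
    obtain ⟨t, ht⟩ : ∃ t, t ∈ (univ.erase (0 : K)).erase 1 := by
      apply Finset.card_pos.1
      rw [Finset.card_erase_of_mem (by simp), hF]
      omega
    simp only [mem_erase, mem_univ, and_true] at ht
    obtain ⟨D, hD, hD2, hsupp⟩ := exists_subcode_ncard_le_card A j j' c 1 hA _ _
      (fun i => (hAW i _).2 (hjW c hc t ht.2 i))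
      (fun i => (hAW i _).2 (hjW e he 1 one_ne_zero i)) (by simp [hjS])
      (by simpa [hj'S, hjj'] using ht.1) (by simpa [hjS] using hce.symm) (by simp [hj'S, hjj'])
    refine ⟨D, hD, hD2, hsupp.trans ?_⟩
    let W' : Fin m → Finset K := fun i =>
      if i ∈ insert j S then (if i = j then {c} else {1}) else if i = j' then {1}
        else univ.erase 0
    have hW' : (Fintype.piFinset W').card = (Fintype.card K - 1) ^ (m - k - 2) := by
      have hcard : (insert j S).card = k + 1 := by rw [Finset.card_insert_of_notMem hjS, hS]
      have hpr := prod_ite_mem_ite_eq (insert j S) (j := j') (by simp [hjj', hj'S]) 1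
        (Fintype.card K - 1)
      rw [hcard, one_mul, Nat.sub_sub] at hpr
      rw [Fintype.card_piFinset, Nat.sub_sub, ← hpr]
      refine Finset.prod_congr rfl fun i _ => ?_
      simp only [W']
      split_ifs
      · simp
      · simp
      · simp
      · exact hF
    have hsub : Fintype.piFinset W' ⊆ Fintype.piFinset W := by
      refine Fintype.piFinset_subset _ _ fun i => ?_
      simp only [W, W', Finset.mem_insert]
      by_cases h1 : i = j
      · subst h1
        simp [hjS, hc]
      by_cases h2 : i ∈ S
      · simp [h1, h2]
      by_cases h3 : i = j'
      · simp [h3, hj'S, hjj']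
      · simp [h1, h2, h3]
    rw [← hW, ← hW', ← Finset.card_sdiff_of_subset hsub]
    refine Finset.card_le_card fun z hz => ?_
    simp only [mem_filter, mem_univ, true_and, hAW] at hz
    rw [Finset.mem_sdiff]
    refine ⟨Fintype.mem_piFinset.2 hz.1, fun hz' => ?_⟩
    rw [Fintype.mem_piFinset] at hz'
    have h1 : z j = c := by simpa [W'] using hz' j
    have h2 : z j' = 1 := by simpa [W', hjj', hj'S] using hz' j'
    exact hz.2.elim (fun h => h h1) (fun h => h h2)

/-- Lower bound for supports of two-dimensional subcodes of degree `d ≤ k (q - 2) + l`. -/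
theorem pow_mul_le_ncard_support {K : Type*} [Field K] [Fintype K] (hq : 3 ≤ Fintype.card K)
    {m d k l : ℕ} (hl1 : 1 ≤ l) (hl2 : l ≤ Fintype.card K - 2)
    (hd : d ≤ k * (Fintype.card K - 2) + l)
    (D : Submodule K ({x : Fin m → K // ∀ i, x i ≠ 0} → K))
    (hD : D ≤ torusCode K m d) (hD2 : Module.finrank K D = 2) :
    ((Fintype.card K : ℤ) - 1) ^ m *
        (((Fintype.card K : ℤ) - 1) * ((Fintype.card K : ℤ) - l) - 1) ≤
      ((Fintype.card K : ℤ) - 1) ^ (k + 2) * ({x | ∃ v ∈ D, v x ≠ 0}.ncard : ℤ) := by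
  obtain ⟨a, b, j, ha0, ha1, hb0, hb1, hsa, hsb, hlt, key⟩ := exists_boxes hq D hD hD2
  have hd' : (d : ℤ) ≤ k * ((Fintype.card K : ℤ) - 1 - 1) + l := by
    zify [show 2 ≤ Fintype.card K by omega] at hd
    linarith
  have h := pow_card_mul_le_two_boxes (n := (Fintype.card K : ℤ) - 1) (by omega) a b univ
    (mem_univ j) (fun i _ => ha0 i) (fun i _ => ha1 i) (fun i _ => hb0 i) (fun i _ => hb1 i) hlt
    k l (by omega) (by omega) (hsa.trans hd') (hsb.trans hd')
  rw [Finset.card_fin, sub_add_cancel] at h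
  refine h.trans (mul_le_mul_of_nonneg_left key (pow_nonneg (by omega) _))

/-- Lower bound for supports of two-dimensional subcodes in high degree. -/
theorem sub_le_ncard_support {K : Type*} [Field K] [Fintype K] (hq : 3 ≤ Fintype.card K)
    {m d k l : ℕ} (hm : k + 1 = m) (hl2 : l ≤ Fintype.card K - 2)
    (hd : l = Fintype.card K - 2 ∨ d ≤ k * (Fintype.card K - 2) + l)
    (D : Submodule K ({x : Fin m → K // ∀ i, x i ≠ 0} → K))
    (hD : D ≤ torusCode K m d) (hD2 : Module.finrank K D = 2) :
    (Fintype.card K : ℤ) - l ≤ ({x | ∃ v ∈ D, v x ≠ 0}.ncard : ℤ) := by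
  obtain ⟨a, b, j, ha0, ha1, hb0, hb1, hsa, hsb, hlt, key⟩ := exists_boxes hq D hD hD2
  have hsum : ∑ i, a i ≤ k * ((Fintype.card K : ℤ) - 1 - 1) + l := by
    rcases hd with rfl | hd
    · refine (Finset.sum_le_card_nsmul _ _ _ fun i _ => ha1 i).trans ?_
      rw [Finset.card_fin, ← hm, nsmul_eq_mul, Nat.cast_sub (by omega)]
      push_cast
      linarith
    · zify [show 2 ≤ Fintype.card K by omega] at hd
      linarith
  have h := pow_card_mul_le_prod (n := (Fintype.card K : ℤ) - 1) (by omega) a univ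
    (fun i _ => ha0 i) (fun i _ => ha1 i) k l (by omega) (by omega) hsum
  subst hm
  rw [Finset.card_fin] at h
  have h1 := le_of_mul_le_mul_left h (pow_pos (by omega) _)
  have h2 : 0 < (a j - b j) * ∏ i ∈ univ.erase j, ((Fintype.card K : ℤ) - 1 - b i) :=
    mul_pos (by linarith) (Finset.prod_pos fun i _ => by linarith [hb1 i])
  linarith

theorem GHW_eq {K : Type*} [Field K] {ι : Type*} {C : Submodule K (ι → K)} {r N : ℕ}
    (hle : ∃ D ≤ C, Module.finrank K D = r ∧ {x : ι | ∃ v ∈ D, v x ≠ 0}.ncard ≤ N)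
    (hge : ∀ D ≤ C, Module.finrank K D = r → N ≤ {x : ι | ∃ v ∈ D, v x ≠ 0}.ncard) :
    GHW C r = N := by
  obtain ⟨D, hDC, hD, hN⟩ := hle
  rw [GHW]
  refine le_antisymm (le_trans (Nat.sInf_le ⟨D, hDC, hD, rfl⟩) hN) (le_csInf ⟨_, D, hDC, hD, rfl⟩ ?_)
  rintro _ ⟨E, hEC, hE, rfl⟩
  exact hge E hEC hE

/-- Let `F_q` be a finite field with `q ≥ 3`, let `s ≥ 3`, and let
`δ_T(d,2)` be the second generalized Hamming weight of the degree-`d` code on the projective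
torus `T ⊆ ℙ^{s-1}`, i.e. of the affine cartesian code on `(F_q ∖ {0})^{s-1}`.  Let `d ≥ 1`
and let `k ≥ 0`, `1 ≤ ℓ ≤ q−2` be the unique integers with `d = k(q−2) + ℓ`; set
`η = (q−2)(s−2)` and `γ = (q−2)(s−1)`.  Then
`δ_T(d,2) = (q−1)^{s−(k+3)}·[(q−1)(q−ℓ) − 1]` if `1 ≤ d ≤ η`,
`δ_T(d,2) = q − ℓ` if `η < d < γ`, and `δ_T(d,2) = 2` if `d ≥ γ`. -/
theorem stmt_18 {K : Type*} [Field K] [Fintype K] (hq : 3 ≤ Fintype.card K)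
    {s : ℕ} (hs : 3 ≤ s) (d k ℓ : ℕ) (hd1 : 1 ≤ d)
    (hk : 0 ≤ k) (hl1 : 1 ≤ ℓ) (hl2 : ℓ ≤ Fintype.card K - 2)
    (hd : d = k * (Fintype.card K - 2) + ℓ) :
    (d ≤ (Fintype.card K - 2) * (s - 2) →
      (GHW (torusCode K (s - 1) d) 2 : ℤ) =
        ((Fintype.card K : ℤ) - 1) ^ (s - (k + 3)) *
          (((Fintype.card K : ℤ) - 1) * ((Fintype.card K : ℤ) - (ℓ : ℤ)) - 1)) ∧
    ((Fintype.card K - 2) * (s - 2) < d → d < (Fintype.card K - 2) * (s - 1) →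
      (GHW (torusCode K (s - 1) d) 2 : ℤ) = (Fintype.card K : ℤ) - (ℓ : ℤ)) ∧
    ((Fintype.card K - 2) * (s - 1) ≤ d → GHW (torusCode K (s - 1) d) 2 = 2) := by
  obtain ⟨m, rfl⟩ : ∃ m, s = m + 1 := ⟨s - 1, by omega⟩
  have hpos : 0 < Fintype.card K - 2 := by omega
  rw [Nat.add_sub_cancel]
  refine ⟨fun h => ?_, fun h1 h2 => ?_, fun h => ?_⟩
  · have hkm : k + 1 < m := by
      have h' : k * (Fintype.card K - 2) < (m + 1 - 2) * (Fintype.card K - 2) := by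
        rw [mul_comm (m + 1 - 2)]
        omega
      have := lt_of_mul_lt_mul_right' h'
      omega
    obtain ⟨t, rfl⟩ : ∃ t, m = t + (k + 2) := ⟨m - (k + 2), by omega⟩
    have e1 : t + (k + 2) + 1 - (k + 3) = t := by omega
    have e2 : t + (k + 2) - k - 1 = t + 1 := by omega
    have e3 : t + (k + 2) - k - 2 = t := by omega
    have hup := (exists_subcode_ncard_le hq hl1 hl2 hd.ge (by omega)).2 hkm
    rw [e2, e3] at hup
    have hle : (Fintype.card K - 1) ^ t ≤ (Fintype.card K - ℓ) * (Fintype.card K - 1) ^ (t + 1) :=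
      calc (Fintype.card K - 1) ^ t ≤ (Fintype.card K - 1) ^ (t + 1) :=
            Nat.pow_le_pow_right (by omega) (by omega)
        _ ≤ _ := Nat.le_mul_of_pos_left _ (by omega)
    have hcast : (((Fintype.card K - ℓ) * (Fintype.card K - 1) ^ (t + 1) -
        (Fintype.card K - 1) ^ t : ℕ) : ℤ) = ((Fintype.card K : ℤ) - 1) ^ t *
          (((Fintype.card K : ℤ) - 1) * ((Fintype.card K : ℤ) - (ℓ : ℤ)) - 1) := by
      rw [Nat.cast_sub hle, Nat.cast_mul, Nat.cast_pow, Nat.cast_pow,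
        Nat.cast_sub (by omega : ℓ ≤ Fintype.card K), Nat.cast_sub (by omega : 1 ≤ Fintype.card K)]
      push_cast
      ring
    rw [e1, ← hcast, Nat.cast_inj]
    refine GHW_eq hup fun D hD hD2 => ?_
    have hlow := pow_mul_le_ncard_support hq hl1 hl2 hd.le D hD hD2
    rw [pow_add _ t, mul_comm (_ ^ t), mul_assoc] at hlow
    have := le_of_mul_le_mul_left hlow (pow_pos (by omega) _)
    rw [← hcast] at this
    exact_mod_cast this
  · have hkm : k + 1 = m := by
      have h' : k * (Fintype.card K - 2) < m * (Fintype.card K - 2) := by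
        rw [mul_comm m]
        omega
      have h'' : (m + 1 - 2) * (Fintype.card K - 2) < (k + 1) * (Fintype.card K - 2) := by
        rw [mul_comm (m + 1 - 2), add_one_mul]
        omega
      have := lt_of_mul_lt_mul_right' h'
      have := lt_of_mul_lt_mul_right' h''
      omega
    rw [← Nat.cast_sub (by omega : ℓ ≤ Fintype.card K), Nat.cast_inj]
    refine GHW_eq ((exists_subcode_ncard_le hq hl1 hl2 hd.ge (by omega)).1 hkm) fun D hD hD2 => ?_
    have := sub_le_ncard_support hq hkm hl2 (Or.inr hd.le) D hD hD2
    omega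
  · obtain ⟨k', rfl⟩ : ∃ k', m = k' + 1 := ⟨m - 1, by omega⟩
    have hd' : k' * (Fintype.card K - 2) + (Fintype.card K - 2) ≤ d := by
      rw [← add_one_mul, mul_comm]
      exact h
    have hup := (exists_subcode_ncard_le hq hpos le_rfl hd' (Nat.lt_succ_self _)).1 rfl
    rw [show Fintype.card K - (Fintype.card K - 2) = 2 by omega] at hup
    refine GHW_eq hup fun D hD hD2 => ?_
    have := sub_le_ncard_support hq rfl le_rfl (Or.inl rfl) D hD hD2
    omega
end
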